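/- arXiv:1601.02818 — 5 statements merged into one kernel-verified Lean document; each statement's English description precedes it below -/
import Mathlib

section
/- Let A_i : Fin m_i → ℤ^n and ω_i : Fin m_i → ℝ for i = 1, …, n, and set m := m_1 + ⋯ + m_n. Suppose p ∈ ℝ^n is an isolated point of the intersection T(A_1, ω_1) ∩ ⋯ ∩ T(A_n, ω_n), i.e., p lies in the intersection and there is an open ball around p meeting the intersection only in p. Then for Lebesgue-almost every ω' = (ω'_1, …, ω'_n) ∈ ℝ^{m_1} × ⋯ × ℝ^{m_n}, the following holds: for every ε > 0 there exists δ > 0 such that for every t with 0 < t < δ, the set T(A_1, ω_1 + t·ω'_1) ∩ ⋯ ∩ T(A_n, ω_n + t·ω'_n) ∩ B(p, ε) is nonempty, where B(p, ε) is the open ball of radius ε centered at p. -/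
open Pointwise MeasureTheory

/-- The dot product on `ℝⁿ`. -/
noncomputable def dotp (n : ℕ) (x y : Fin n → ℝ) : ℝ := ∑ l, x l * y l

/-- The tropical hypersurface of the configuration `A` with coefficients `ω`:
the set of points where the maximum of `j ↦ ω j + ⟪A j, x⟫` is attained at
at least two distinct indices. -/
def tropH (n m : ℕ) (A : Fin m → Fin n → ℝ) (ω : Fin m → ℝ) : Set (Fin n → ℝ) :=
  {x | ∃ j k : Fin m, j ≠ k ∧
    (∀ l, ω l + dotp n (A l) x ≤ ω j + dotp n (A j) x) ∧
    ω j + dotp n (A j) x = ω k + dotp n (A k) x}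

open Filter Topology Function

section TropicalTies

variable {ι : Type*} [Fintype ι] {J : ι → Type*}

/-- The linear map whose coordinates are the differences of the chosen pairs of exponents. -/
def gap (a : ∀ i, J i → (ι → ℝ) →ₗ[ℝ] ℝ) (j k : ∀ i, J i) : (ι → ℝ) →ₗ[ℝ] (ι → ℝ) :=
  LinearMap.pi fun i => a i (k i) - a i (j i)

omit [Fintype ι] in
@[simp]
theorem gap_apply (a : ∀ i, J i → (ι → ℝ) →ₗ[ℝ] ℝ) (j k : ∀ i, J i) (y : ι → ℝ) (i : ι) :
    gap a j k y i = a i (k i) y - a i (j i) y := rfl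

/-- At `y`, each maximum of `l ↦ c i l + a i l y` is attained at both `j i` and `k i`. -/
def IsTie (a : ∀ i, J i → (ι → ℝ) →ₗ[ℝ] ℝ) (c : ∀ i, J i → ℝ) (j k : ∀ i, J i) (y : ι → ℝ) :
    Prop :=
  ∀ i, (∀ l, c i l + a i l y ≤ c i (j i) + a i (j i) y) ∧
    c i (j i) + a i (j i) y = c i (k i) + a i (k i) y

/-- The coefficients for which the hypersurfaces meet transversally along some pairs of exponents
at some point. -/
def tieSet (a : ∀ i, J i → (ι → ℝ) →ₗ[ℝ] ℝ) : Set (∀ i, J i → ℝ) :=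
  {c | ∃ j k, Injective (gap a j k) ∧ ∃ y, IsTie a c j k y}

/-- The coefficient of index `l` in the `i`-th function. -/
def coeff (i : ι) (l : J i) : (∀ i, J i → ℝ) →ₗ[ℝ] ℝ :=
  (LinearMap.proj l : (J i → ℝ) →ₗ[ℝ] ℝ) ∘ₗ LinearMap.proj i

omit [Fintype ι] in
@[simp]
theorem coeff_apply (i : ι) (l : J i) (c : ∀ i, J i → ℝ) : coeff i l c = c i l := rfl

/-- The point at which the chosen pairs of affine functions agree, as a linear function of the
coefficients. -/
noncomputable def tiePoint {a : ∀ i, J i → (ι → ℝ) →ₗ[ℝ] ℝ} {j k : ∀ i, J i}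
    (h : Injective (gap a j k)) : (∀ i, J i → ℝ) →ₗ[ℝ] (ι → ℝ) :=
  (LinearEquiv.ofInjectiveEndo (gap a j k) h).symm.toLinearMap ∘ₗ
    LinearMap.pi fun i => coeff i (j i) - coeff i (k i)

variable {a : ∀ i, J i → (ι → ℝ) →ₗ[ℝ] ℝ} {c : ∀ i, J i → ℝ} {j k : ∀ i, J i} {y : ι → ℝ}

theorem gap_tiePoint (h : Injective (gap a j k)) (c : ∀ i, J i → ℝ) (i : ι) :
    a i (k i) (tiePoint h c) - a i (j i) (tiePoint h c) = c i (j i) - c i (k i) := by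
  have := congrFun ((LinearEquiv.ofInjectiveEndo (gap a j k) h).apply_symm_apply
    (fun i => c i (j i) - c i (k i))) i
  exact this

theorem eq_tiePoint (h : Injective (gap a j k))
    (hy : ∀ i, c i (j i) + a i (j i) y = c i (k i) + a i (k i) y) : y = tiePoint h c := by
  apply h
  ext i
  have := gap_tiePoint h c i
  have := hy i
  simp only [gap_apply]
  linarith

theorem IsTie.eq_tiePoint (hy : IsTie a c j k y) (h : Injective (gap a j k)) :
    y = tiePoint h c :=
  _root_.eq_tiePoint h fun i => (hy i).2

variable [∀ i, Fintype (J i)]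

theorem continuous_tiePoint (h : Injective (gap a j k)) : Continuous (tiePoint h) :=
  (tiePoint h).continuous_of_finiteDimensional

omit [∀ i, Fintype (J i)] in
theorem continuous_exponent (a : ∀ i, J i → (ι → ℝ) →ₗ[ℝ] ℝ) (i : ι) (l : J i) :
    Continuous (a i l) :=
  (a i l).continuous_of_finiteDimensional

theorem isClosed_tieSet (a : ∀ i, J i → (ι → ℝ) →ₗ[ℝ] ℝ) : IsClosed (tieSet a) := by
  classical
  have : tieSet a = ⋃ q : {q : (∀ i, J i) × (∀ i, J i) // Injective (gap a q.1 q.2)},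
      {c | IsTie a c q.1.1 q.1.2 (tiePoint q.2 c)} := by
    ext c
    simp only [tieSet, Set.mem_ofPred_eq, Set.mem_iUnion]
    constructor
    · rintro ⟨j, k, h, y, hy⟩
      exact ⟨⟨(j, k), h⟩, hy.eq_tiePoint h ▸ hy⟩
    · rintro ⟨⟨⟨j, k⟩, h⟩, hy⟩
      exact ⟨j, k, h, _, hy⟩
  rw [this]
  refine isClosed_iUnion_of_finite fun q => ?_
  have hc := continuous_tiePoint q.2
  have ha := continuous_exponent a
  simp only [IsTie, Set.ofPred_forall, Set.ofPred_and]
  refine isClosed_iInter fun i => IsClosed.inter (isClosed_iInter fun l => ?_) ?_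
  · exact isClosed_le (by fun_prop) (by fun_prop)
  · exact isClosed_eq (by fun_prop) (by fun_prop)

omit [Fintype ι] [∀ i, Fintype (J i)] in
theorem injective_gap_update [DecidableEq ι] (h : Injective (gap a j k)) {i₀ : ι} {u : ι → ℝ}
    (hu : gap a j k u = Pi.single i₀ 1) {j₁ k₁ : J i₀} (hne : a i₀ j₁ u ≠ a i₀ k₁ u) :
    Injective (gap a (update j i₀ j₁) (update k i₀ k₁)) := by
  rw [injective_iff_map_eq_zero]
  intro w hw
  have hwi : ∀ i ≠ i₀, gap a j k w i = 0 := fun i hi => by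
    simpa [hi] using congrFun hw i
  have hwu : w = (gap a j k w i₀) • u := by
    apply h
    ext i
    rw [map_smul, hu]
    by_cases hi : i = i₀
    · subst hi; simp
    · simp [hi, hwi i hi]
  have h₀ : a i₀ k₁ w - a i₀ j₁ w = 0 := by simpa using congrFun hw i₀
  rw [hwu, map_smul, map_smul, ← smul_sub, smul_eq_zero] at h₀
  rcases h₀ with h₀ | h₀
  · rw [hwu, h₀, zero_smul]
  · exact absurd (sub_eq_zero.1 h₀).symm hne

theorem tieSet_mem_nhds (h : Injective (gap a j k)) (hy : IsTie a c j k y) (i₀ : ι)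
    (hs : ∀ i, i ≠ i₀ → ∀ l, l ≠ j i → l ≠ k i →
      c i l + a i l y < c i (j i) + a i (j i) y) : tieSet a ∈ 𝓝 c := by
  classical
  obtain ⟨u, hu⟩ := LinearMap.injective_iff_surjective.1 h (Pi.single i₀ 1)
  have hu₀ : a i₀ (k i₀) u - a i₀ (j i₀) u = 1 := by simpa using congrFun hu i₀
  have hui : ∀ i, i ≠ i₀ → a i (k i) u = a i (j i) u := fun i hi => by
    have := congrFun hu i
    simp only [gap_apply, Pi.single_apply, hi, if_false] at this
    linarith
  have hY := continuous_tiePoint h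
  have ha := continuous_exponent a
  have hyc := hy.eq_tiePoint h
  obtain ⟨ρ, ⟨hρ₁, hρ₂⟩, hρ⟩ : ∃ ρ : ℝ, ((∀ i, i ≠ i₀ → ∀ l, l ≠ j i → l ≠ k i →
      c i l + a i l (tiePoint h c + ρ • u) < c i (j i) + a i (j i) (tiePoint h c + ρ • u)) ∧
      ∀ i, i ≠ i₀ → ∀ l, l ≠ j i → l ≠ k i →
      c i l + a i l (tiePoint h c + (-ρ) • u) <
        c i (j i) + a i (j i) (tiePoint h c + (-ρ) • u)) ∧ 0 < ρ := by
    have key : ∀ s : ℝ, ∀ᶠ ρ : ℝ in 𝓝 0, ∀ i, i ≠ i₀ → ∀ l, l ≠ j i → l ≠ k i →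
        c i l + a i l (tiePoint h c + (s * ρ) • u) <
          c i (j i) + a i (j i) (tiePoint h c + (s * ρ) • u) := by
      intro s
      simp only [eventually_all]
      intro i hi l hlj hlk
      refine ContinuousAt.eventually_lt (by fun_prop) (by fun_prop) ?_
      simpa [← hyc] using hs i hi l hlj hlk
    have h₁ := (key 1).filter_mono (nhdsWithin_le_nhds (s := Set.Ioi 0))
    have h₂ := (key (-1)).filter_mono (nhdsWithin_le_nhds (s := Set.Ioi 0))
    simpa using ((h₁.and h₂).and self_mem_nhdsWithin).exists
  have hnear : ∀ ρ : ℝ, (∀ i, i ≠ i₀ → ∀ l, l ≠ j i → l ≠ k i →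
      c i l + a i l (tiePoint h c + ρ • u) < c i (j i) + a i (j i) (tiePoint h c + ρ • u)) →
      ∀ᶠ c' in 𝓝 c, ∀ i, i ≠ i₀ → ∀ l, l ≠ j i → l ≠ k i →
      c' i l + a i l (tiePoint h c' + ρ • u) <
        c' i (j i) + a i (j i) (tiePoint h c' + ρ • u) := by
    intro ρ hρ
    simp only [eventually_all]
    intro i hi l hlj hlk
    exact ContinuousAt.eventually_lt (by fun_prop) (by fun_prop) (hρ i hi l hlj hlk)
  have hleft : ∀ᶠ c' in 𝓝 c, ∀ l, a i₀ (j i₀) u < a i₀ l u →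
      c' i₀ l + a i₀ l (tiePoint h c' + (-ρ) • u) <
        c' i₀ (j i₀) + a i₀ (j i₀) (tiePoint h c' + (-ρ) • u) := by
    simp only [eventually_all]
    intro l hl
    refine ContinuousAt.eventually_lt (by fun_prop) (by fun_prop) ?_
    have := (hy i₀).1 l
    simp only [map_add, map_smul, smul_eq_mul, ← hyc]
    nlinarith
  have hright : ∀ᶠ c' in 𝓝 c, ∀ l, a i₀ l u ≤ a i₀ (j i₀) u →
      c' i₀ l + a i₀ l (tiePoint h c' + ρ • u) <
        c' i₀ (k i₀) + a i₀ (k i₀) (tiePoint h c' + ρ • u) := by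
    simp only [eventually_all]
    intro l hl
    refine ContinuousAt.eventually_lt (by fun_prop) (by fun_prop) ?_
    have := (hy i₀).1 l
    have := (hy i₀).2
    simp only [map_add, map_smul, smul_eq_mul, ← hyc]
    nlinarith
  filter_upwards [hnear ρ hρ₁, hnear (-ρ) hρ₂, hleft, hright] with c' hp hm hl hr
  set Y := tiePoint h c'
  let M : J i₀ → Set ℝ := fun r => {τ | ∀ l, c' i₀ l + a i₀ l (Y + τ • u) ≤
    c' i₀ r + a i₀ r (Y + τ • u)}
  have hM : ∀ r, IsClosed (M r) := fun r => by
    simp only [M, Set.ofPred_forall]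
    exact isClosed_iInter fun l => isClosed_le (by fun_prop) (by fun_prop)
  have hex : ∀ τ, ∃ r, τ ∈ M r := fun τ => by
    have : Nonempty (J i₀) := ⟨j i₀⟩
    exact Finite.exists_max fun l => c' i₀ l + a i₀ l (Y + τ • u)
  obtain ⟨τ, hτ, h₁, h₂⟩ := isPreconnected_closed_iff.1 (isPreconnected_Icc (a := -ρ) (b := ρ))
    (⋃ r : {r // a i₀ r u ≤ a i₀ (j i₀) u}, M r) (⋃ r : {r // a i₀ (j i₀) u < a i₀ r u}, M r)
    (isClosed_iUnion_of_finite fun r => hM r) (isClosed_iUnion_of_finite fun r => hM r)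
    (fun τ _ => by
      obtain ⟨r, hr⟩ := hex τ
      rcases le_or_gt (a i₀ r u) (a i₀ (j i₀) u) with hr' | hr'
      · exact Or.inl (Set.mem_iUnion.2 ⟨⟨r, hr'⟩, hr⟩)
      · exact Or.inr (Set.mem_iUnion.2 ⟨⟨r, hr'⟩, hr⟩))
    ⟨-ρ, ⟨le_rfl, by linarith⟩, by
      obtain ⟨r, hr'⟩ := hex (-ρ)
      exact Set.mem_iUnion.2 ⟨⟨r, not_lt.1 fun hlt => (hl r hlt).not_ge (hr' _)⟩, hr'⟩⟩
    ⟨ρ, ⟨by linarith, le_rfl⟩, by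
      obtain ⟨r, hr'⟩ := hex ρ
      exact Set.mem_iUnion.2 ⟨⟨r, not_le.1 fun hle => (hr r hle).not_ge (hr' _)⟩, hr'⟩⟩
  obtain ⟨⟨j₁, hj₁⟩, hj₁M⟩ := Set.mem_iUnion.1 h₁
  obtain ⟨⟨k₁, hk₁⟩, hk₁M⟩ := Set.mem_iUnion.1 h₂
  refine ⟨update j i₀ j₁, update k i₀ k₁,
    injective_gap_update h hu (hj₁.trans_lt hk₁).ne, Y + τ • u, fun i => ?_⟩
  by_cases hi : i = i₀
  · subst hi
    simp only [update_self]
    exact ⟨hj₁M, le_antisymm (hk₁M _) (hj₁M _)⟩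
  · have hg := gap_tiePoint h c' i
    have hui' := hui i hi
    simp only [update_of_ne hi]
    have htie : c' i (j i) + a i (j i) (Y + τ • u) = c' i (k i) + a i (k i) (Y + τ • u) := by
      simp only [map_add, map_smul, smul_eq_mul, hui']
      linarith
    refine ⟨fun l => ?_, htie⟩
    by_cases hlj : l = j i
    · rw [hlj]
    by_cases hlk : l = k i
    · rw [hlk, htie]
    have hp' := hp i hi l hlj hlk
    have hm' := hm i hi l hlj hlk
    obtain ⟨hτ₁, hτ₂⟩ := hτ
    simp only [map_add, map_smul, smul_eq_mul] at hp' hm' ⊢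
    rcases le_total (a i l u) (a i (j i) u) with hle | hle <;> nlinarith

/-- The excess of the affine function of index `l` over the tied pair, as a linear function of the
coefficients. -/
noncomputable def excess (h : Injective (gap a j k)) (i : ι) (l : J i) :
    (∀ i, J i → ℝ) →ₗ[ℝ] ℝ :=
  coeff i l - coeff i (j i) + (a i l - a i (j i)) ∘ₗ tiePoint h

omit [∀ i, Fintype (J i)] in
theorem excess_apply (h : Injective (gap a j k)) (i : ι) (l : J i) (c : ∀ i, J i → ℝ) :
    excess h i l c = c i l - c i (j i) + (a i l (tiePoint h c) - a i (j i) (tiePoint h c)) := rfl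

open Classical in
omit [∀ i, Fintype (J i)] in
theorem tiePoint_single (h : Injective (gap a j k)) {i : ι} {l : J i} (hlj : l ≠ j i)
    (hlk : l ≠ k i) : tiePoint h (Pi.single i (Pi.single l 1)) = 0 := by
  symm
  apply eq_tiePoint h
  intro i'
  by_cases hi : i' = i
  · subst hi
    simp [hlj.symm, hlk.symm]
  · simp [hi]

open Classical in
omit [∀ i, Fintype (J i)] in
theorem excess_single_self (h : Injective (gap a j k)) {i : ι} {l : J i} (hlj : l ≠ j i)
    (hlk : l ≠ k i) : excess h i l (Pi.single i (Pi.single l 1)) = 1 := by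
  simp [excess_apply, tiePoint_single h hlj hlk, hlj.symm]

open Classical in
omit [∀ i, Fintype (J i)] in
theorem excess_single_of_ne (h : Injective (gap a j k)) {i i' : ι} {l : J i} (hlj : l ≠ j i)
    (hlk : l ≠ k i) (hi : i' ≠ i) (l' : J i') :
    excess h i' l' (Pi.single i (Pi.single l 1)) = 0 := by
  simp [excess_apply, tiePoint_single h hlj hlk, hi]

theorem dense_forall_ne_zero {E κ : Type*} [NormedAddCommGroup E] [NormedSpace ℝ E]
    [FiniteDimensional ℝ E] [Finite κ] (f : κ → E →ₗ[ℝ] ℝ) (hf : ∀ q, f q ≠ 0) :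
    Dense {x | ∀ q, f q x ≠ 0} := by
  have := FiniteDimensional.complete ℝ E
  rw [Set.ofPred_forall]
  refine dense_iInter_of_isOpen (fun q => ?_) fun q => ?_
  · exact isOpen_ne_fun (f q).continuous_of_finiteDimensional continuous_const
  · change Dense ((LinearMap.ker (f q) : Set E)ᶜ)
    rw [← interior_eq_empty_iff_dense_compl, ← Set.not_nonempty_iff_eq_empty]
    intro hne
    exact hf q (LinearMap.ker_eq_top.1 (Submodule.eq_top_of_nonempty_interior' _ hne))

theorem nonempty_interior_tieSet (h : Injective (gap a j k)) : (interior (tieSet a)).Nonempty := by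
  classical
  rcases isEmpty_or_nonempty ι with hι | ⟨⟨i₀⟩⟩
  · have : tieSet a = Set.univ :=
      Set.eq_univ_of_forall fun c => ⟨j, k, h, 0, fun i => isEmptyElim i⟩
    rw [this, interior_univ]
    exact Set.univ_nonempty
  · let c : ∀ i, J i → ℝ := fun i l => if l = j i ∨ l = k i then 0 else -1
    refine ⟨c, mem_interior_iff_mem_nhds.2 (tieSet_mem_nhds (y := 0) h (fun i => ⟨fun l => ?_, ?_⟩)
      i₀ fun i _ l hlj hlk => ?_)⟩
    · simp only [c, map_zero]
      split_ifs <;> simp_all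
    · simp [c]
    · simp [c, hlj, hlk]

/-- A system of hypersurfaces admitting a transversal choice of pairs of exponents has a
transversal intersection point for all coefficients. -/
theorem tieSet_eq_univ (h₀ : Injective (gap a j k)) : tieSet a = Set.univ := by
  classical
  let Q := {q : (∀ i, J i) × (∀ i, J i) // Injective (gap a q.1 q.2)}
  let P : Q → Type _ := fun q => {x : Σ i, J i // x.2 ≠ q.1.1 x.1 ∧ x.2 ≠ q.1.2 x.1}
  let Φ : ∀ q : Q, P q → (∀ i, J i → ℝ) →ₗ[ℝ] ℝ := fun q x => excess q.2 x.1.1 x.1.2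
  obtain ⟨c₀, hc₀, hgen⟩ : ∃ c₀ ∈ tieSet a, ∀ q x, Φ q x c₀ ≠ 0 := by
    obtain ⟨c₀, hc₀, hgen⟩ := (dense_forall_ne_zero (fun x : Σ q, P q => Φ x.1 x.2)
      fun ⟨q, ⟨⟨i, l⟩, hl⟩⟩ h => by
        have := excess_single_self q.2 hl.1 hl.2
        rw [show excess q.2 i l = 0 from h] at this
        simp at this).inter_open_nonempty _ isOpen_interior (nonempty_interior_tieSet h₀)
    exact ⟨c₀, interior_subset hc₀, fun q x => hgen ⟨q, x⟩⟩
  have hdense := dense_forall_ne_zero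
    (fun x : Σ q, {x : P q × P q // x.1.1.1 ≠ x.2.1.1} =>
      Φ x.1 x.2.1.1 c₀ • Φ x.1 x.2.1.2 - Φ x.1 x.2.1.2 c₀ • Φ x.1 x.2.1.1) (by
    rintro ⟨q, ⟨⟨x, ⟨⟨i, l⟩, hl⟩⟩, hx⟩⟩ h
    have h' := LinearMap.congr_fun h (Pi.single i (Pi.single l 1))
    have h₁ := excess_single_self q.2 hl.1 hl.2
    have h₂ := excess_single_of_ne q.2 hl.1 hl.2 hx x.1.2
    simp only [Φ, LinearMap.sub_apply, LinearMap.smul_apply, h₁, h₂] at h'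
    exact hgen q x (by simpa using h'))
  refine Set.eq_univ_of_univ_subset ?_
  rw [← hdense.closure_eq]
  refine closure_minimal (fun c hc => ?_) (isClosed_tieSet a)
  let γ : ℝ → ∀ i, J i → ℝ := fun s => c₀ + s • (c - c₀)
  have hγ : Continuous γ := by fun_prop
  suffices Set.Icc (0 : ℝ) 1 ⊆ γ ⁻¹' tieSet a by
    simpa [γ] using this ⟨zero_le_one, le_rfl⟩
  refine (((isClosed_tieSet a).preimage hγ).inter isClosed_Icc).Icc_subset_of_forall_mem_nhdsWithin
    (by simpa [γ] using hc₀) ?_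
  rintro s ⟨⟨j, k, h, y, hy⟩, -⟩
  refine mem_nhdsWithin_of_mem_nhds (hγ.continuousAt ?_)
  rcases isEmpty_or_nonempty ι with hι | ⟨⟨i₀⟩⟩
  · exact univ_mem' fun c => ⟨j, k, h, 0, fun i => isEmptyElim i⟩
  by_contra hcon
  have hextra : ∀ i₀, ∃ i, i ≠ i₀ ∧ ∃ l, (l ≠ j i ∧ l ≠ k i) ∧ excess h i l (γ s) = 0 := by
    intro i₀
    by_contra! hno
    refine hcon (tieSet_mem_nhds h hy i₀ fun i hi l hlj hlk => ?_)
    have h₁ := hno i hi l ⟨hlj, hlk⟩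
    rw [excess_apply, ← hy.eq_tiePoint h] at h₁
    refine lt_of_le_of_ne ((hy i).1 l) fun heq => h₁ (by linarith)
  obtain ⟨i₁, -, l₁, hl₁, he₁⟩ := hextra i₀
  obtain ⟨i₂, hi, l₂, hl₂, he₂⟩ := hextra i₁
  let q : Q := ⟨(j, k), h⟩
  have hg := hgen q ⟨⟨i₁, l₁⟩, hl₁⟩
  have hψ := hc ⟨q, ⟨⟨⟨⟨i₁, l₁⟩, hl₁⟩, ⟨⟨i₂, l₂⟩, hl₂⟩⟩, hi.symm⟩⟩
  simp only [Φ, q, γ, map_add, map_smul, map_sub, LinearMap.sub_apply, LinearMap.smul_apply,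
    smul_eq_mul] at hg hψ he₁ he₂
  have hs : s ≠ 0 := by
    rintro rfl
    exact hg (by simpa using he₁)
  refine hψ ((mul_eq_zero.1 (?_ : s * _ = 0)).resolve_left hs)
  linear_combination excess h i₁ l₁ c₀ * he₂ - excess h i₂ l₂ c₀ * he₁

/-- If the fans of at least two exponents each meet only in the origin, then some pairs of
exponents have linearly independent differences. -/
theorem exists_injective_gap (a : ∀ i, J i → (ι → ℝ) →ₗ[ℝ] ℝ)
    (hJ : ∀ i, ∃ j k : J i, j ≠ k)
    (ha : ∀ y, (∀ i, ∃ j k, j ≠ k ∧ (∀ l, a i l y ≤ a i j y) ∧ a i j y = a i k y) → y = 0) :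
    ∃ j k, Injective (gap a j k) := by
  classical
  let P : Set (Finset ι) := {R | ∃ w : ι → (ι → ℝ) →ₗ[ℝ] ℝ,
    (∀ z, (∀ i, w i z = 0) → z = 0) ∧ ∀ i ∈ R, ∃ j k : J i, w i = a i k - a i j}
  obtain ⟨R, hR⟩ := (Set.toFinite P).exists_maximal
    ⟨∅, fun i => LinearMap.proj i, fun z hz => funext hz, by simp⟩
  obtain ⟨w, hw, hwR⟩ := hR.prop
  choose j₀ k₀ hne using hJ
  have hpair : ∀ i, ∃ j k : J i, (i ∈ R → w i = a i k - a i j) ∧ (i ∉ R → j = j₀ i ∧ k = k₀ i) := by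
    intro i
    by_cases hi : i ∈ R
    · obtain ⟨j, k, hjk⟩ := hwR i hi
      exact ⟨j, k, fun _ => hjk, fun h => absurd hi h⟩
    · exact ⟨j₀ i, k₀ i, fun h => absurd h hi, fun _ => ⟨rfl, rfl⟩⟩
  choose j₁ k₁ hjkR hjk₀ using hpair
  by_cases hall : ∀ i, i ∈ R
  · refine ⟨j₁, k₁, (injective_iff_map_eq_zero _).2 fun z hz => hw z fun i => ?_⟩
    rw [hjkR i (hall i)]
    exact congrFun hz i
  push Not at hall
  obtain ⟨i₁, hi₁⟩ := hall
  let b : ∀ i, J i → (ι → ℝ) →ₗ[ℝ] ℝ := fun i l =>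
    if i ∈ R then a i l else if l = k₀ i then w i else 0
  have hb : Injective (gap b j₁ k₁) := by
    refine (injective_iff_map_eq_zero _).2 fun z hz => hw z fun i => ?_
    have hzi := congrFun hz i
    by_cases hi : i ∈ R
    · rw [hjkR i hi]
      simpa [b, hi] using hzi
    · obtain ⟨hj, hk⟩ := hjk₀ i hi
      simpa [b, hi, hj, hk, hne i] using hzi
  let c : ∀ i, J i → ℝ := fun i l => if i = i₁ ∧ l = k₀ i then -1 else 0
  obtain ⟨j, k, h, y, hy⟩ : c ∈ tieSet b := by rw [tieSet_eq_univ hb]; trivial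
  have hgap : ∀ i, ∃ z, gap b j k z i ≠ 0 := fun i => by
    obtain ⟨z, hz⟩ := LinearMap.injective_iff_surjective.1 h (Pi.single i 1)
    exact ⟨z, by rw [hz]; simp⟩
  have hjk : ∀ i, j i ≠ k i := fun i hjk => by
    obtain ⟨z, hz⟩ := hgap i
    simp [hjk] at hz
  have hy₀ : ∀ i, i ≠ i₁ → gap b j k y i = 0 := fun i hi => by
    have := (hy i).2
    simp only [c, hi, false_and, if_false, zero_add] at this
    simp [this]
  have hy₁ : gap b j k y i₁ ≠ 0 := by
    have htie := (hy i₁).2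
    obtain ⟨z, hz⟩ := hgap i₁
    have hne₁ : ¬(j i₁ = k₀ i₁ ∧ k i₁ = k₀ i₁) := fun h => hjk i₁ (h.1.trans h.2.symm)
    simp only [gap_apply, b, c, hi₁, if_false, true_and] at htie hz ⊢
    intro h₀
    by_cases hj : j i₁ = k₀ i₁ <;> by_cases hk : k i₁ = k₀ i₁
    · exact hne₁ ⟨hj, hk⟩
    · simp only [hj, hk, if_true, if_false] at htie h₀
      linarith
    · simp only [hj, hk, if_true, if_false] at htie h₀
      linarith
    · simp [hj, hk] at hz
  have hyR : ∀ i, i ∉ R → ∀ l l', a i l' y = a i l y := by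
    intro i hi l l'
    by_contra hd
    have hmem : insert i R ∈ P := by
      refine ⟨fun m => if m = i then a i l' - a i l else
        LinearMap.proj (if m = i₁ then i else m) ∘ₗ gap b j k, fun z hz => ?_, fun m hm => ?_⟩
      · have hz₀ : ∀ m, m ≠ i₁ → gap b j k z m = 0 := by
          intro m hm
          by_cases hmi : m = i
          · subst hmi
            simpa [hm.symm] using hz i₁
          · simpa [hm, hmi] using hz m
        have hzy : z = (gap b j k z i₁ / gap b j k y i₁) • y := by
          apply h
          ext m
          rw [map_smul, Pi.smul_apply, smul_eq_mul]
          by_cases hm : m = i₁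
          · subst hm
            rw [div_mul_cancel₀ _ hy₁]
          · rw [hz₀ m hm, hy₀ m hm, mul_zero]
        have hzd : a i l' z - a i l z = 0 := by simpa using hz i
        rw [hzy, map_smul, map_smul, ← smul_sub, smul_eq_zero] at hzd
        rcases hzd with hzd | hzd
        · rw [hzy, hzd, zero_smul]
        · exact absurd (sub_eq_zero.1 hzd) hd
      · rcases eq_or_ne m i with rfl | hmi
        · exact ⟨l, l', by simp⟩
        · have hmR := Finset.mem_of_mem_insert_of_ne hm hmi
          refine ⟨j m, k m, ?_⟩
          have hm₁ : m ≠ i₁ := fun h => hi₁ (h ▸ hmR)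
          ext z
          simp [hmi, hm₁, b, hmR]
    exact hi (hR.le_of_ge hmem (Finset.subset_insert i R) (Finset.mem_insert_self i R))
  refine absurd (ha y fun i => ?_) fun h₀ => hy₁ (by simp [h₀])
  by_cases hi : i ∈ R
  · have hii : i ≠ i₁ := fun h => hi₁ (h ▸ hi)
    have := hy i
    simp only [c, b, hii, hi, false_and, if_false, if_true, zero_add] at this
    exact ⟨j i, k i, hjk i, this⟩
  · exact ⟨j₀ i, k₀ i, hne i, fun l => (hyR i hi _ _).le, hyR i hi _ _⟩

end TropicalTies

/-- The dot product with a fixed vector, as a linear functional. -/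
noncomputable def dotpLinear (n : ℕ) (x : Fin n → ℝ) : (Fin n → ℝ) →ₗ[ℝ] ℝ where
  toFun := dotp n x
  map_add' y z := by simp [dotp, mul_add, Finset.sum_add_distrib]
  map_smul' t y := by simp [dotp, Finset.mul_sum, mul_left_comm]

theorem dotp_add_smul (n : ℕ) (x p y : Fin n → ℝ) (t : ℝ) :
    dotp n x (p + t • y) = dotp n x p + t * dotp n x y := by
  change dotpLinear n x (p + t • y) = dotpLinear n x p + t * dotpLinear n x y
  simp

/-- The indices at which the maximum at `p` is attained. -/
abbrev Active {n m : ℕ} (A : Fin m → Fin n → ℝ) (ω : Fin m → ℝ) (p : Fin n → ℝ) : Type :=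
  {j : Fin m // ∀ l, ω l + dotp n (A l) p ≤ ω j + dotp n (A j) p}

theorem eventually_mem_tropH {n m : ℕ} {A : Fin m → Fin n → ℝ} {ω c : Fin m → ℝ}
    {p y : Fin n → ℝ} {j k : Active A ω p} (hjk : j ≠ k)
    (hmax : ∀ l : Active A ω p, c l + dotp n (A l) y ≤ c j + dotp n (A j) y)
    (htie : c j + dotp n (A j) y = c k + dotp n (A k) y) :
    ∀ᶠ t : ℝ in 𝓝[>] 0, p + t • y ∈ tropH n m A (ω + t • c) := by
  have hle : ∀ᶠ t : ℝ in 𝓝[>] 0, ∀ l,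
      (ω l + dotp n (A l) p) + t * (c l + dotp n (A l) y) ≤
        (ω j + dotp n (A j) p) + t * (c j + dotp n (A j) y) := by
    rw [eventually_all]
    intro l
    by_cases hl : ∀ l', ω l' + dotp n (A l') p ≤ ω l + dotp n (A l) p
    · filter_upwards [self_mem_nhdsWithin] with t ht
      exact add_le_add (j.2 l) (mul_le_mul_of_nonneg_left (hmax ⟨l, hl⟩) (le_of_lt ht))
    · push Not at hl
      obtain ⟨l', hl'⟩ := hl
      refine nhdsWithin_le_nhds (Eventually.mono (ContinuousAt.eventually_lt (x₀ := (0 : ℝ))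
        (by fun_prop) (by fun_prop) ?_) fun t ht => ht.le)
      simpa using hl'.trans_le (j.2 l')
  filter_upwards [hle] with t ht
  have hexp : ∀ l, (ω + t • c) l + dotp n (A l) (p + t • y) =
      (ω l + dotp n (A l) p) + t * (c l + dotp n (A l) y) := fun l => by
    rw [dotp_add_smul, Pi.add_apply, Pi.smul_apply, smul_eq_mul]
    ring
  refine ⟨j, k, fun h => hjk (Subtype.ext h), fun l => ?_, ?_⟩
  · rw [hexp, hexp]
    exact ht l
  · rw [hexp, hexp, htie, le_antisymm (k.2 j) (j.2 k)]

/-- an isolated tropical solution persists under generic small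
perturbations of the coefficients: if `p` is an isolated point of
`T(A₁,ω₁) ∩ ⋯ ∩ T(Aₙ,ωₙ)`, then for almost every `ω'`, for every `ε > 0` there is
`δ > 0` such that for all `0 < t < δ` the perturbed intersection meets `B(p,ε)`. -/
theorem isolated_solution_persists (n : ℕ) (m : Fin n → ℕ)
    (A : ∀ i : Fin n, Fin (m i) → Fin n → ℤ) (ω : ∀ i : Fin n, Fin (m i) → ℝ)
    (p : Fin n → ℝ)
    (hp : p ∈ ⋂ i, tropH n (m i) (fun j l => ((A i j l : ℝ))) (ω i))
    (hiso : ∃ r > 0,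
      (⋂ i, tropH n (m i) (fun j l => ((A i j l : ℝ))) (ω i)) ∩ Metric.ball p r = {p}) :
    ∀ᵐ ω' ∂(volume : Measure (∀ i : Fin n, Fin (m i) → ℝ)),
      ∀ ε > 0, ∃ δ > 0, ∀ t : ℝ, 0 < t → t < δ →
        ((⋂ i, tropH n (m i) (fun j l => ((A i j l : ℝ))) (ω i + t • ω' i)) ∩
          Metric.ball p ε).Nonempty := by
  classical
  obtain ⟨r, hr, hball⟩ := hiso
  let B : ∀ i : Fin n, Fin (m i) → Fin n → ℝ := fun i j l => A i j l
  let a : ∀ i, Active (B i) (ω i) p → (Fin n → ℝ) →ₗ[ℝ] ℝ := fun i j => dotpLinear n (B i j)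
  have hnear : ∀ (y : Fin n → ℝ) (ε : ℝ), 0 < ε →
      ∀ᶠ t : ℝ in 𝓝[>] 0, p + t • y ∈ Metric.ball p ε := fun y ε hε =>
    nhdsWithin_le_nhds <| ContinuousAt.preimage_mem_nhds (f := fun t : ℝ => p + t • y)
      (by fun_prop) (by simpa using Metric.ball_mem_nhds p hε)
  obtain ⟨j, k, hjk⟩ := exists_injective_gap a (fun i => by
    obtain ⟨j, k, hjk, hmax, htie⟩ := Set.mem_iInter.1 hp i
    exact ⟨⟨j, hmax⟩, ⟨k, fun l => htie ▸ hmax l⟩, fun h => hjk (congrArg Subtype.val h)⟩) (by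
    intro y hy
    have hmem : ∀ᶠ t : ℝ in 𝓝[>] 0, ∀ i, p + t • y ∈ tropH n (m i) (B i) (ω i) := by
      rw [eventually_all]
      intro i
      obtain ⟨j, k, hne, hmax, htie⟩ := hy i
      simpa using eventually_mem_tropH (c := 0) hne
        (fun l => by simpa using! hmax l) (by simpa using! htie)
    obtain ⟨t, ⟨ht, htr⟩, ht₀⟩ := ((hmem.and (hnear y r hr)).and self_mem_nhdsWithin).exists
    have hpt : p + t • y ∈ ({p} : Set (Fin n → ℝ)) := hball ▸ ⟨Set.mem_iInter.2 ht, htr⟩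
    simpa [(show (0 : ℝ) < t from ht₀).ne'] using hpt)
  refine Eventually.of_forall fun ω' ε hε => ?_
  obtain ⟨j, k, hinj, y, hy⟩ : (fun i (l : Active (B i) (ω i) p) => ω' i l) ∈ tieSet a := by
    rw [tieSet_eq_univ hjk]
    trivial
  have hmem : ∀ᶠ t : ℝ in 𝓝[>] 0, ∀ i, p + t • y ∈ tropH n (m i) (B i) (ω i + t • ω' i) := by
    rw [eventually_all]
    intro i
    have hne : j i ≠ k i := fun h => by
      obtain ⟨z, hz⟩ := LinearMap.injective_iff_surjective.1 hinj (Pi.single i 1)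
      simpa [h] using congrFun hz i
    exact eventually_mem_tropH hne (hy i).1 (hy i).2
  obtain ⟨δ, hδ, hsub⟩ := mem_nhdsGT_iff_exists_Ioo_subset.1 (hmem.and (hnear y ε hε))
  refine ⟨δ, hδ, fun t ht₀ ht => ?_⟩
  obtain ⟨ht₁, ht₂⟩ := hsub ⟨ht₀, ht⟩
  exact ⟨p + t • y, Set.mem_iInter.2 ht₁, ht₂⟩
end

section
/- Let L ⊆ ℝ^n be a linear subspace spanned by vectors with rational coordinates, and let A_1, …, A_k ⊆ ℤ^n be finite sets, each containing at least two distinct points. Then the set L ∩ T(A_1, 0) ∩ ⋯ ∩ T(A_k, 0) (which contains 0 and hence is nonempty) has Hausdorff dimension at least dim(L) − k; i.e., (dim L : ℝ≥0∞) ≤ dimH(L ∩ T(A_1, 0) ∩ ⋯ ∩ T(A_k, 0)) + k. -/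
open Pointwise MeasureTheory

/-- The tropical hypersurface (with all coefficients `0`) of a point
configuration `A ⊆ ℝⁿ`: the points `x` where `max_{a ∈ A} ⟪a, x⟫` is attained
at at least two distinct points of `A`. -/
def tropHS (n : ℕ) (A : Set (Fin n → ℝ)) : Set (Fin n → ℝ) :=
  {x | ∃ a ∈ A, ∃ b ∈ A, a ≠ b ∧
    (∀ c ∈ A, dotp n c x ≤ dotp n a x) ∧ dotp n a x = dotp n b x}

open Topology Module

section TiedMax

variable {κ ι V : Type*} [AddCommGroup V] [Module ℝ V]

/-- The points at which, for every `i`, the maximum over `j ∈ B i` of the affine functions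
`ω i j + a i j` is attained at two distinct indices. -/
def tiedMax (a : κ → ι → V →ₗ[ℝ] ℝ) (ω : κ → ι → ℝ) (B : κ → Finset ι) : Set V :=
  {x | ∀ i, ∃ j ∈ B i, ∃ j' ∈ B i, j ≠ j' ∧ ω i j + a i j x = ω i j' + a i j' x ∧
    ∀ l ∈ B i, ω i l + a i l x ≤ ω i j + a i j x}

open Classical in
/-- The indices in `B i` at which the maximum of `ω i j + a i j p` is attained. -/
noncomputable def activeIndices (a : κ → ι → V →ₗ[ℝ] ℝ) (ω : κ → ι → ℝ) (B : κ → Finset ι)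
    (p : V) (i : κ) : Finset ι :=
  {j ∈ B i | ∀ l ∈ B i, ω i l + a i l p ≤ ω i j + a i j p}

lemma mem_activeIndices {a : κ → ι → V →ₗ[ℝ] ℝ} {ω : κ → ι → ℝ} {B : κ → Finset ι} {p : V}
    {i : κ} {j : ι} : j ∈ activeIndices a ω B p i ↔
      j ∈ B i ∧ ∀ l ∈ B i, ω i l + a i l p ≤ ω i j + a i j p := by
  simp [activeIndices]

lemma activeIndices_subset (a : κ → ι → V →ₗ[ℝ] ℝ) (ω : κ → ι → ℝ) (B : κ → Finset ι) (p : V)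
    (i : κ) : activeIndices a ω B p i ⊆ B i :=
  fun _ hj ↦ (mem_activeIndices.1 hj).1

lemma two_le_card_activeIndices {a : κ → ι → V →ₗ[ℝ] ℝ} {ω : κ → ι → ℝ} {B : κ → Finset ι}
    {p : V} (hp : p ∈ tiedMax a ω B) (i : κ) : 2 ≤ (activeIndices a ω B p i).card := by
  obtain ⟨j, hj, j', hj', hne, heq, hmax⟩ := hp i
  exact Finset.one_lt_card.2 ⟨j, mem_activeIndices.2 ⟨hj, hmax⟩, j',
    mem_activeIndices.2 ⟨hj', heq ▸ hmax⟩, hne⟩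

lemma eventually_add_smul_mem_tiedMax [Finite κ] {a : κ → ι → V →ₗ[ℝ] ℝ} {ω : κ → ι → ℝ}
    {B : κ → Finset ι} {p x : V} (hx : x ∈ tiedMax a 0 (activeIndices a ω B p)) :
    ∀ᶠ t : ℝ in 𝓝[>] 0, p + t • x ∈ tiedMax a ω B := by
  refine Filter.eventually_all.2 fun i ↦ ?_
  obtain ⟨j, hj, j', hj', hne, heq, hmax⟩ := hx i
  have hj2 := mem_activeIndices.1 hj
  have hj2' := mem_activeIndices.1 hj'
  have hp : ω i j + a i j p = ω i j' + a i j' p :=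
    le_antisymm (hj2'.2 j hj2.1) (hj2.2 j' hj2'.1)
  simp only [Pi.zero_apply, zero_add] at heq hmax
  have key : ∀ l ∈ B i, ∀ᶠ t : ℝ in 𝓝[>] 0,
      ω i l + a i l (p + t • x) ≤ ω i j + a i j (p + t • x) := by
    intro l hl
    by_cases hla : l ∈ activeIndices a ω B p i
    · filter_upwards [self_mem_nhdsWithin] with t ht
      have h1 := hj2.2 l hl
      have h2 := mul_le_mul_of_nonneg_left (hmax l hla) (le_of_lt ht)
      simp only [map_add, map_smul, smul_eq_mul]
      linarith
    · have hlt : ω i l + a i l p < ω i j + a i j p := by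
        refine lt_of_le_of_ne (hj2.2 l hl) fun h ↦ hla (mem_activeIndices.2 ⟨hl, ?_⟩)
        rw [h]; exact hj2.2
      have hc : Continuous fun t : ℝ ↦
          (ω i j + a i j (p + t • x)) - (ω i l + a i l (p + t • x)) := by
        simp only [map_add, map_smul, smul_eq_mul]; fun_prop
      have := (hc.tendsto' 0 _ rfl).eventually_const_lt (u := 0) (by simpa using hlt)
      filter_upwards [nhdsWithin_le_nhds this] with t ht
      linarith
  filter_upwards [(Filter.eventually_all_finset _).2 key] with t ht
  refine ⟨j, hj2.1, j', hj2'.1, hne, ?_, ht⟩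
  simp only [map_add, map_smul, smul_eq_mul, heq]
  linarith

lemma smul_mem_tiedMax {a : κ → ι → V →ₗ[ℝ] ℝ} {ω : κ → ι → ℝ} {B : κ → Finset ι} {x : V}
    (hx : x ∈ tiedMax a ω B) {c : ℝ} (hc : 0 ≤ c) : c • x ∈ tiedMax a (c • ω) B := by
  intro i
  obtain ⟨j, hj, j', hj', hne, heq, hmax⟩ := hx i
  refine ⟨j, hj, j', hj', hne, ?_, fun l hl ↦ ?_⟩
  · simp only [Pi.smul_apply, smul_eq_mul, map_smul, ← mul_add, heq]
  · simp only [Pi.smul_apply, smul_eq_mul, map_smul, ← mul_add]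
    exact mul_le_mul_of_nonneg_left (hmax l hl) hc

end TiedMax

section Existence

variable {κ ι V : Type*} [NormedAddCommGroup V] [InnerProductSpace ℝ V] [FiniteDimensional ℝ V]

lemma isClosed_setOf_mem_tiedMax {X : Type*} [TopologicalSpace X] (a : κ → ι → V →ₗ[ℝ] ℝ)
    (B : κ → Finset ι) {w : X → κ → ι → ℝ} {f : X → V} (hw : Continuous w) (hf : Continuous f) :
    IsClosed {z | f z ∈ tiedMax a (w z) B} := by
  have hc : ∀ i j, Continuous fun z ↦ w z i j + a i j (f z) := fun i j ↦
    ((continuous_apply j).comp ((continuous_apply i).comp hw)).add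
      ((a i j).continuous_of_finiteDimensional.comp hf)
  have : {z | f z ∈ tiedMax a (w z) B} = ⋂ i, ⋃ j ∈ B i, ⋃ j' ∈ B i,
      {z | j ≠ j' ∧ w z i j + a i j (f z) = w z i j' + a i j' (f z) ∧
        ∀ l ∈ B i, w z i l + a i l (f z) ≤ w z i j + a i j (f z)} := by
    ext z; simp only [tiedMax, Set.mem_ofPred_eq, Set.mem_iInter, Set.mem_iUnion, exists_prop]
  rw [this]
  refine isClosed_iInter fun i ↦ isClosed_biUnion_finset fun j _ ↦
    isClosed_biUnion_finset fun j' _ ↦ ?_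
  refine isClosed_const.and ((isClosed_eq (hc i j) (hc i j')).and ?_)
  simp only [Set.ofPred_forall]
  exact isClosed_biInter fun l _ ↦ isClosed_le (hc i l) (hc i j)

lemma isCompact_tiedMax_inter {a : κ → ι → V →ₗ[ℝ] ℝ} {ω : κ → ι → ℝ} {B : κ → Finset ι}
    {u : V →ₗ[ℝ] ℝ} (h0 : ∀ x ∈ tiedMax a 0 B, 0 ≤ u x → x = 0) :
    IsCompact {x | x ∈ tiedMax a ω B ∧ -1 ≤ u x} := by
  have hu : Continuous u := u.continuous_of_finiteDimensional
  let Z : Set (V × ℝ) := (Metric.sphere 0 1 ×ˢ Set.Icc 0 1) ∩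
    ({z | z.1 ∈ tiedMax a (z.2 • ω) B} ∩ {z | -z.2 ≤ u z.1})
  have hZ : IsCompact Z := by
    refine ((isCompact_sphere _ _).prod isCompact_Icc).inter_right (IsClosed.inter ?_ ?_)
    · exact isClosed_setOf_mem_tiedMax a B (by fun_prop) (by fun_prop)
    · exact isClosed_le (by fun_prop) (by fun_prop)
  obtain ⟨δ, hδ, hZδ⟩ : ∃ δ > 0, ∀ z ∈ Z, δ ≤ z.2 := by
    rcases Z.eq_empty_or_nonempty with h | h
    · exact ⟨1, one_pos, by simp [h]⟩
    · obtain ⟨z, hz, hmin⟩ := hZ.exists_isMinOn h continuous_snd.continuousOn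
      refine ⟨z.2, lt_of_le_of_ne hz.1.2.1 fun h ↦ ?_, fun y hy ↦ hmin hy⟩
      have h1 := hz.2.1
      have h2 := hz.2.2
      simp only [Set.mem_ofPred_eq, ← h, zero_smul, neg_zero] at h1 h2
      have h3 := hz.1.1
      simp [h0 _ h1 h2] at h3
  refine (isCompact_closedBall (0 : V) (max 1 δ⁻¹)).of_isClosed_subset
    ((isClosed_setOf_mem_tiedMax a B continuous_const continuous_id).inter
      (isClosed_le continuous_const hu)) fun x hx ↦ ?_
  rw [mem_closedBall_zero_iff]
  by_contra! hlt
  have hx1 : 1 < ‖x‖ := (le_max_left _ _).trans_lt hlt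
  have hx0 : 0 < ‖x‖ := one_pos.trans hx1
  have := hZδ (‖x‖⁻¹ • x, ‖x‖⁻¹) ⟨⟨by simp [norm_smul, hx0.ne'],
    by simp, inv_le_one_of_one_le₀ hx1.le⟩, smul_mem_tiedMax hx.1 (by positivity), by
      have := mul_le_mul_of_nonneg_left hx.2 (inv_nonneg.2 hx0.le)
      simpa using this⟩
  have h2 := (le_max_right _ _).trans_lt hlt
  exact absurd (inv_lt_of_inv_lt₀ hδ h2) (not_lt.2 this)

lemma exists_local_max {a : κ → ι → V →ₗ[ℝ] ℝ} {ω : κ → ι → ℝ} {B : κ → Finset ι}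
    {u : V →ₗ[ℝ] ℝ} (h0 : ∀ x ∈ tiedMax a 0 B, 0 ≤ u x → x = 0) (hω : 0 ∈ tiedMax a ω B) :
    ∃ p ∈ tiedMax a ω B, -1 < u p ∧ ∃ ε > 0, ∀ x ∈ tiedMax a ω B, -1 ≤ u x →
      u x + ε * ‖x‖ ^ 2 ≤ u p + ε * ‖p‖ ^ 2 := by
  have hu : Continuous u := u.continuous_of_finiteDimensional
  have hK := isCompact_tiedMax_inter (ω := ω) h0
  obtain ⟨R, hR⟩ := hK.isBounded.exists_norm_le
  have hR0 : 0 ≤ R := (norm_nonneg _).trans (hR 0 ⟨hω, by simp⟩)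
  set ε : ℝ := (2 * (R ^ 2 + 1))⁻¹ with hε
  have hε0 : 0 < ε := by positivity
  obtain ⟨p, hp, hmax⟩ := hK.exists_isMaxOn ⟨0, hω, by simp⟩
    (f := fun x ↦ u x + ε * ‖x‖ ^ 2) (by fun_prop)
  refine ⟨p, hp.1, ?_, ε, hε0, fun x hx hx' ↦ hmax ⟨hx, hx'⟩⟩
  have h1 : u 0 + ε * ‖(0 : V)‖ ^ 2 ≤ u p + ε * ‖p‖ ^ 2 := hmax ⟨hω, by simp⟩
  have h2 : ‖p‖ ^ 2 ≤ R ^ 2 := pow_le_pow_left₀ (norm_nonneg _) (hR p hp) 2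
  have h3 : ε * (R ^ 2 + 1) = 1 / 2 := by rw [hε]; field_simp
  simp only [map_zero, norm_zero] at h1
  nlinarith

/-- A system of fewer than `dim V` tied maxima of linear forms has a nonzero solution in every
closed half space. -/
theorem exists_ne_zero_mem_tiedMax [Fintype κ] (a : κ → ι → V →ₗ[ℝ] ℝ) (B : κ → Finset ι)
    (hB : ∀ i, 2 ≤ (B i).card) (hd : Fintype.card κ < finrank ℝ V) (u : V →ₗ[ℝ] ℝ) :
    ∃ x ∈ tiedMax a 0 B, x ≠ 0 ∧ 0 ≤ u x := by
  classical
  induction hN : ∑ i, (B i).card using Nat.strong_induction_on generalizing B u with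
  | _ N ih =>
  have of_neg_mem : ∀ x ∈ tiedMax a 0 B, -x ∈ tiedMax a 0 B → x ≠ 0 →
      ∃ x ∈ tiedMax a 0 B, x ≠ 0 ∧ 0 ≤ u x := by
    intro x hx hx' hne
    rcases le_total 0 (u x) with h | h
    · exact ⟨x, hx, hne, h⟩
    · exact ⟨-x, hx', neg_ne_zero.2 hne, by simpa using h⟩
  have mem_of_tie : ∀ x, (∀ i, ∀ j ∈ B i, ∀ l ∈ B i, a i j x = a i l x) →
      x ∈ tiedMax a 0 B := by
    intro x hx i
    obtain ⟨j, hj, j', hj', hne⟩ := Finset.one_lt_card.1 (hB i)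
    exact ⟨j, hj, j', hj', hne, by simp [hx i j hj j' hj'], fun l hl ↦ by simp [hx i l hl j hj]⟩
  by_cases h2 : ∀ i, (B i).card = 2
  · choose b b' hne hb using fun i ↦ Finset.card_eq_two.1 (h2 i)
    let f : V →ₗ[ℝ] (κ → ℝ) := LinearMap.pi fun i ↦ a i (b i) - a i (b' i)
    have hf : LinearMap.ker f ≠ ⊥ := LinearMap.ker_ne_bot_of_finrank_lt (by simpa using hd)
    obtain ⟨x, hx, hx0⟩ := Submodule.exists_mem_ne_zero_of_ne_bot hf
    have hx' : ∀ i, a i (b i) x = a i (b' i) x := fun i ↦ by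
      have := congrFun (LinearMap.mem_ker.1 hx) i
      simpa [f, sub_eq_zero] using this
    refine of_neg_mem x (mem_of_tie x ?_) (mem_of_tie (-x) ?_) hx0 <;>
    · intro i j hj l hl
      rw [hb i, Finset.mem_insert, Finset.mem_singleton] at hj hl
      rcases hj with rfl | rfl <;> rcases hl with rfl | rfl <;> simp [hx' i]
  push Not at h2
  obtain ⟨i₀, hi₀⟩ := h2
  have h3 : 3 ≤ (B i₀).card := by have := hB i₀; omega
  let ω : ι → κ → ι → ℝ := fun c i j ↦ if i = i₀ ∧ j = c then -1 else 0
  have hωle : ∀ c i j, ω c i j ≤ 0 := fun c i j ↦ by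
    simp only [ω]
    split_ifs <;> norm_num
  have hzero : ∀ c ∈ B i₀, ∀ i, ∃ j ∈ B i, ∃ j' ∈ B i, j ≠ j' ∧ ω c i j = 0 ∧ ω c i j' = 0 := by
    intro c hc i
    by_cases hi : i = i₀
    · subst hi
      obtain ⟨j, hj, j', hj', hne⟩ := Finset.one_lt_card.1
        (by rw [Finset.card_erase_of_mem hc]; omega : 1 < ((B i).erase c).card)
      rw [Finset.mem_erase] at hj hj'
      exact ⟨j, hj.2, j', hj'.2, hne, by simp [ω, hj.1], by simp [ω, hj'.1]⟩
    · obtain ⟨j, hj, j', hj', hne⟩ := Finset.one_lt_card.1 (hB i)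
      exact ⟨j, hj, j', hj', hne, by simp [ω, hi], by simp [ω, hi]⟩
  by_cases hlift : ∀ c ∈ B i₀, ∃ p, ∀ i, ∀ j ∈ B i, ∀ l ∈ B i,
      ω c i j + a i j p = ω c i l + a i l p
  · choose! p hp using hlift
    have hpne : ∀ c ∈ B i₀, p c ≠ 0 := by
      intro c hc h
      obtain ⟨l, hl, hlc⟩ := Finset.exists_mem_ne (by omega : 1 < (B i₀).card) c
      have := hp c hc i₀ c hc l hl
      simp [ω, h, hlc] at this
    have hpmem : ∀ c ∈ B i₀, -p c ∈ tiedMax a 0 B := by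
      intro c hc i
      obtain ⟨j, hj, j', hj', hne, hωj, hωj'⟩ := hzero c hc i
      refine ⟨j, hj, j', hj', hne, ?_, fun l hl ↦ ?_⟩
      · have := hp c hc i j hj j' hj'
        simp only [Pi.zero_apply, map_neg]
        linarith
      · have := hp c hc i j hj l hl
        simp only [Pi.zero_apply, map_neg]
        linarith [hωle c i l]
    by_cases hs : ∑ c ∈ B i₀, p c = 0
    · by_contra! hcon
      have hneg : ∀ c ∈ B i₀, 0 < u (p c) := fun c hc ↦ by
        simpa using hcon _ (hpmem c hc) (neg_ne_zero.2 (hpne c hc))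
      have := Finset.sum_pos hneg (Finset.card_pos.1 (by omega))
      rw [← map_sum, hs, map_zero] at this
      exact lt_irrefl _ this
    · have htie : ∀ i, ∀ j ∈ B i, ∀ l ∈ B i,
          a i j (∑ c ∈ B i₀, p c) = a i l (∑ c ∈ B i₀, p c) := by
        intro i j hj l hl
        have hsum : ∀ j ∈ B i, ∑ c ∈ B i₀, ω c i j = if i = i₀ then -1 else 0 := by
          intro j hj
          by_cases hi : i = i₀
          · subst hi; simp [ω, hj]
          · simp [ω, hi]
        have := Finset.sum_congr rfl fun c hc ↦ hp c hc i j hj l hl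
        rw [Finset.sum_add_distrib, Finset.sum_add_distrib, hsum j hj, hsum l hl,
          add_right_inj, ← map_sum, ← map_sum] at this
        exact this
      exact of_neg_mem _ (mem_of_tie _ htie) (mem_of_tie _ fun i j hj l hl ↦ by
        rw [map_neg, map_neg, htie i j hj l hl]) hs
  · push Not at hlift
    obtain ⟨c, hc, hlift⟩ := hlift
    by_contra! hcon
    have h0 : ∀ x ∈ tiedMax a 0 B, 0 ≤ u x → x = 0 := fun x hx hux ↦ by
      by_contra hx0
      exact absurd (hcon x hx hx0) (not_lt.2 hux)
    have hω : (0 : V) ∈ tiedMax a (ω c) B := by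
      intro i
      obtain ⟨j, hj, j', hj', hne, hωj, hωj'⟩ := hzero c hc i
      exact ⟨j, hj, j', hj', hne, by simp [hωj, hωj'], fun l _ ↦ by simpa [hωj] using hωle c i l⟩
    obtain ⟨p, hp, hup, ε, hε, hmax⟩ := exists_local_max h0 hω
    obtain ⟨i, j, hj, l, hl, hne⟩ := hlift p
    have hlt : ∑ i, (activeIndices a (ω c) B p i).card < N := by
      rw [← hN]
      refine Finset.sum_lt_sum (fun i _ ↦ Finset.card_le_card (activeIndices_subset ..))
        ⟨i, Finset.mem_univ _, Finset.card_lt_card ((activeIndices_subset ..).ssubset_of_ne ?_)⟩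
      intro h
      have hj' := (mem_activeIndices.1 (h ▸ hj)).2 l hl
      have hl' := (mem_activeIndices.1 (h ▸ hl)).2 j hj
      exact hne (le_antisymm hl' hj')
    obtain ⟨x, hx, hx0, hux⟩ := ih _ hlt _ (two_le_card_activeIndices hp)
      (u + (2 * ε) • (innerₗ V p)) rfl
    have hev : ∀ᶠ t : ℝ in 𝓝[>] 0, -1 < u (p + t • x) := by
      have hc : Continuous fun t : ℝ ↦ u (p + t • x) := by
        simp only [map_add, map_smul, smul_eq_mul]; fun_prop
      exact nhdsWithin_le_nhds
        ((hc.tendsto' 0 _ rfl).eventually_const_lt (by simpa using hup))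
    obtain ⟨t, ⟨ht1, ht2⟩, ht⟩ := ((eventually_add_smul_mem_tiedMax hx).and hev |>.and
      self_mem_nhdsWithin).exists
    have ht0 : 0 < t := ht
    have h4 := hmax _ ht1 ht2.le
    rw [norm_add_sq_real, inner_smul_right, norm_smul, mul_pow, Real.norm_eq_abs, sq_abs] at h4
    simp only [map_add, map_smul, smul_eq_mul, LinearMap.add_apply, LinearMap.smul_apply,
      innerₗ_apply_apply] at h4 hux
    have h5 : 0 < ε * (t ^ 2 * ‖x‖ ^ 2) := by
      have := norm_pos_iff.2 hx0
      positivity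
    nlinarith [mul_nonneg ht0.le hux]

end Existence

section Dimension

/-- If finitely many subspaces have dimension at most `r`, some subspace of codimension at most
`r` meets all of them trivially. -/
lemma exists_submodule_disjoint {V α : Type*} [AddCommGroup V] [Module ℝ V]
    [FiniteDimensional ℝ V] [Finite α] (S : α → Submodule ℝ V) {r : ℕ}
    (hS : ∀ i, finrank ℝ (S i) ≤ r) (m : ℕ) (hm : m + r ≤ finrank ℝ V) :
    ∃ M : Submodule ℝ V, finrank ℝ M = m ∧ ∀ i, Disjoint M (S i) := by
  induction m with
  | zero => exact ⟨⊥, finrank_bot ℝ V, fun i ↦ disjoint_bot_left⟩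
  | succ m ih =>
    obtain ⟨M, hM, hMS⟩ := ih (by omega)
    obtain ⟨v, hv, hvS⟩ : ∃ v, v ∉ M ∧ ∀ i, v ∉ M ⊔ S i := by
      by_contra! hcon
      have hcover : ∀ v, ∃ i : Option α, v ∈ i.elim M fun i ↦ M ⊔ S i := fun v ↦ by
        by_cases h : v ∈ M
        · exact ⟨none, h⟩
        · exact (hcon v h).imp' some fun _ h ↦ h
      obtain ⟨i, hi⟩ := Subspace.exists_eq_top_of_iUnion_eq_univ
        (p := fun i : Option α ↦ i.elim M fun i ↦ M ⊔ S i)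
        (Set.eq_univ_of_forall fun v ↦ Set.mem_iUnion.2 (hcover v))
      cases i with
      | none =>
        have h1 : finrank ℝ M = finrank ℝ V := by rw [show M = ⊤ from hi, finrank_top]
        omega
      | some i =>
        have h1 : finrank ℝ ↥(M ⊔ S i) = finrank ℝ V := by
          rw [show M ⊔ S i = ⊤ from hi, finrank_top]
        have h2 := Submodule.finrank_add_le_finrank_add_finrank M (S i)
        have h3 := hS i
        omega
    refine ⟨M ⊔ Submodule.span ℝ {v}, ?_, fun i ↦ ?_⟩
    · rw [Submodule.finrank_sup_span_singleton hv, hM]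
    · rw [sup_comm]
      refine Disjoint.disjoint_sup_left_of_disjoint_sup_right (hMS i) ?_
      exact (Submodule.disjoint_span_singleton_of_notMem (hvS i)).symm

/-- A convex set containing the origin has Hausdorff dimension at least that of its span. -/
lemma Convex.finrank_span_le_dimH {E : Type*} [NormedAddCommGroup E] [NormedSpace ℝ E]
    [FiniteDimensional ℝ E] {s : Set E} (hs : Convex ℝ s) (h0 : 0 ∈ s) :
    (finrank ℝ (Submodule.span ℝ s) : ENNReal) ≤ dimH s := by
  have himage : (· -ᵥ (0 : E)) '' s = s := by simp
  rw [Real.Convex.dimH_eq_finrank_vectorSpan hs ⟨0, h0⟩,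
    vectorSpan_eq_span_vsub_set_right ℝ h0, himage]

/-- The solution set of `k` tied maxima of linear forms has codimension at most `k`. -/
theorem finrank_le_dimH_tiedMax_add_card {κ ι V : Type*} [Fintype κ] [NormedAddCommGroup V]
    [NormedSpace ℝ V] [FiniteDimensional ℝ V] (a : κ → ι → V →ₗ[ℝ] ℝ) (B : κ → Finset ι)
    (hB : ∀ i, 2 ≤ (B i).card) :
    (finrank ℝ V : ENNReal) ≤ dimH (tiedMax a 0 B) + Fintype.card κ := by
  let C : (∀ i, B i × B i) → Set V := fun f ↦ {x | ∀ i, a i (f i).1 x = a i (f i).2 x ∧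
    ∀ l ∈ B i, a i l x ≤ a i (f i).1 x}
  have hconv : ∀ f, Convex ℝ (C f) := by
    intro f x hx y hy s t hs ht hst i
    refine ⟨?_, fun l hl ↦ ?_⟩
    · simp [(hx i).1, (hy i).1]
    · have h1 := mul_le_mul_of_nonneg_left ((hx i).2 l hl) hs
      have h2 := mul_le_mul_of_nonneg_left ((hy i).2 l hl) ht
      simp only [map_add, map_smul, smul_eq_mul]
      linarith
  by_cases hk : finrank ℝ V ≤ Fintype.card κ
  · exact le_add_left (by exact_mod_cast hk)
  push Not at hk
  let α := {f : ∀ i, B i × B i // ∀ i, (f i).1 ≠ (f i).2}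
  obtain ⟨f, hf⟩ : ∃ f : α, finrank ℝ V ≤
      finrank ℝ (Submodule.span ℝ (C f.1)) + Fintype.card κ := by
    by_contra! hcon
    obtain ⟨M, hM, hMC⟩ := exists_submodule_disjoint (fun f : α ↦ Submodule.span ℝ (C f.1))
      (r := finrank ℝ V - (Fintype.card κ + 1)) (fun f ↦ by have := hcon f; omega)
      (Fintype.card κ + 1) (by omega)
    let e : EuclideanSpace ℝ (Fin (finrank ℝ M)) ≃ₗ[ℝ] M :=
      LinearEquiv.ofFinrankEq _ _ (by simp)
    obtain ⟨x, hx, hx0, -⟩ := exists_ne_zero_mem_tiedMax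
      (fun i j ↦ a i j ∘ₗ M.subtype ∘ₗ e.toLinearMap) B hB (by simp [hM]) 0
    choose j hj j' hj' hne heq hmax using hx
    have hmem : (e x : V) ∈ C fun i ↦ (⟨j i, hj i⟩, ⟨j' i, hj' i⟩) := fun i ↦
      ⟨by simpa using heq i, fun l hl ↦ by simpa using hmax i l hl⟩
    have := Submodule.disjoint_def.1
      (hMC ⟨fun i ↦ (⟨j i, hj i⟩, ⟨j' i, hj' i⟩), fun i h ↦ hne i (congrArg Subtype.val h)⟩)
      (e x) (e x).2 (Submodule.subset_span hmem)
    exact hx0 (by simpa using this)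
  calc (finrank ℝ V : ENNReal)
      ≤ finrank ℝ (Submodule.span ℝ (C f.1)) + Fintype.card κ := by exact_mod_cast hf
    _ ≤ dimH (C f.1) + Fintype.card κ := by
        gcongr
        exact (hconv f.1).finrank_span_le_dimH fun i ↦ by simp
    _ ≤ dimH (tiedMax a 0 B) + Fintype.card κ := by
        gcongr
        intro x hx i
        refine ⟨(f.1 i).1, (f.1 i).1.2, (f.1 i).2, (f.1 i).2.2,
          fun h ↦ f.2 i (Subtype.ext h), ?_, fun l hl ↦ ?_⟩
        · simpa using (hx i).1
        · simpa using (hx i).2 l hl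

end Dimension

/-- dimension bound for the intersection of a rational linear
subspace with `k` tropical hypersurfaces (with zero coefficients) of integral
configurations, each having at least two points:
`dim L ≤ dimH (L ∩ T(A₁,0) ∩ ⋯ ∩ T(A_k,0)) + k`. -/
theorem codim_intersection_bound (n k : ℕ) (L : Submodule ℝ (Fin n → ℝ))
    (hL : ∃ S : Set (Fin n → ℝ), (∀ v ∈ S, ∀ l, ∃ q : ℚ, v l = (q : ℝ)) ∧
      L = Submodule.span ℝ S)
    (A : Fin k → Set (Fin n → ℤ)) (hfin : ∀ i, (A i).Finite)
    (htwo : ∀ i, ∃ a ∈ A i, ∃ b ∈ A i, a ≠ b) :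
    (Module.finrank ℝ L : ENNReal) ≤
      dimH ((L : Set (Fin n → ℝ)) ∩
        ⋂ i, tropHS n ((fun v : Fin n → ℤ => fun l => ((v l : ℝ))) '' A i)) + k := by
  let a : Fin k → (Fin n → ℤ) → L →ₗ[ℝ] ℝ := fun _ v ↦
    (dotProductBilin ℝ ℝ (fun l ↦ (v l : ℝ))) ∘ₗ L.subtype
  have ha : ∀ i v (x : L), a i v x = dotp n (fun l ↦ (v l : ℝ)) x := fun _ _ _ ↦ rfl
  have hcast : Function.Injective fun (v : Fin n → ℤ) (l : Fin n) ↦ (v l : ℝ) :=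
    fun v w h ↦ funext fun l ↦ Int.cast_injective (congrFun h l)
  have hbound := finrank_le_dimH_tiedMax_add_card a (fun i ↦ (hfin i).toFinset) fun i ↦ by
    obtain ⟨v, hv, w, hw, hne⟩ := htwo i
    exact Finset.one_lt_card.2 ⟨v, by simpa using hv, w, by simpa using hw, hne⟩
  rw [Fintype.card_fin, ← isometry_subtype_coe.dimH_image] at hbound
  refine hbound.trans ?_
  gcongr
  rintro _ ⟨x, hx, rfl⟩
  refine ⟨x.2, Set.mem_iInter.2 fun i ↦ ?_⟩
  obtain ⟨v, hv, w, hw, hne, heq, hmax⟩ := hx i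
  simp only [Set.Finite.mem_toFinset, Pi.zero_apply, zero_add, ha] at hv hw heq hmax
  exact ⟨_, ⟨v, hv, rfl⟩, _, ⟨w, hw, rfl⟩, hcast.ne hne, by
    rintro _ ⟨l, hl, rfl⟩
    exact hmax l hl, heq⟩
end

section
/- Let A_i : Fin m_i → ℤ^n and ω_i : Fin m_i → ℝ for i = 1, …, n, and let 𝓘_i ⊆ Fin m_i be arbitrary index subsets. Define τ_i : Fin m_i → ℝ by τ_i j = −1 if j ∈ 𝓘_i and τ_i j = 0 otherwise. Then there exists ε_0 > 0 such that for all ε with 0 < ε < ε_0, the following holds: a tuple M = ((a_1,b_1),…,(a_n,b_n)) with a_i, b_i ∈ Fin m_i ∖ 𝓘_i for all i is a mixed cell of (A_1,…,A_n) with respect to the lifts (τ_1 + ε·ω_1, …, τ_n + ε·ω_n) if and only if M is a mixed cell of the restricted configurations (A_1 restricted to Fin m_1 ∖ 𝓘_1, …, A_n restricted to Fin m_n ∖ 𝓘_n) with respect to the restricted lifts (ω_1 restricted to Fin m_1 ∖ 𝓘_1, …, ω_n restricted to Fin m_n ∖ 𝓘_n). -/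
open Pointwise MeasureTheory

/-- `(a, b)` is a (fully) mixed cell of the configurations `A i` with lifts `ω i`:
the differences `A i (b i) − A i (a i)` are linearly independent, and there is a
normal direction `p` such that in each configuration the lifted maximum of
`j ↦ ω i j + ⟪A i j, p⟫` is attained exactly at `a i` and `b i`. -/
def IsMixedCell {n : ℕ} {ι : Fin n → Type} (A : ∀ i, ι i → Fin n → ℝ)
    (ω : ∀ i, ι i → ℝ) (a b : ∀ i, ι i) : Prop :=
  (∀ i, a i ≠ b i) ∧
  LinearIndependent ℝ (fun i => A i (b i) - A i (a i)) ∧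
  ∃ p : Fin n → ℝ, ∀ i, ∀ j : ι i,
    (ω i j + dotp n (A i j) p ≤ ω i (a i) + dotp n (A i (a i)) p) ∧
    (ω i j + dotp n (A i j) p = ω i (a i) + dotp n (A i (a i)) p ↔ j = a i ∨ j = b i)

theorem dotp_smul_right (n : ℕ) (c : ℝ) (x p : Fin n → ℝ) :
    dotp n x (c • p) = c * dotp n x p := by
  simp only [dotp, Finset.mul_sum, Pi.smul_apply, smul_eq_mul]
  exact Finset.sum_congr rfl fun l _ => by ring

/-- If `f` vanishes off `I`, a mixed cell for the lifts `f + ε • ω` avoiding `I` is a mixed cell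
of the restrictions to the complement of `I` for the lifts `ω`. -/
theorem IsMixedCell.restrict {n : ℕ} {ι : Fin n → Type} {A : ∀ i, ι i → Fin n → ℝ}
    {f ω : ∀ i, ι i → ℝ} {I : ∀ i, Set (ι i)} (hf : ∀ i, ∀ j ∉ I i, f i j = 0)
    {ε : ℝ} (hε : 0 < ε) {a b : ∀ i, ι i} (ha : ∀ i, a i ∉ I i) (hb : ∀ i, b i ∉ I i)
    (h : IsMixedCell A (fun i j => f i j + ε * ω i j) a b) :
    IsMixedCell (ι := fun i => {j : ι i // j ∉ I i}) (fun i j => A i j.1) (fun i j => ω i j.1)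
      (fun i => ⟨a i, ha i⟩) (fun i => ⟨b i, hb i⟩) := by
  obtain ⟨hne, hli, p, hp⟩ := h
  refine ⟨fun i hi => hne i (congrArg Subtype.val hi), hli, ε⁻¹ • p, fun i ⟨j, hj⟩ => ?_⟩
  have scale : ∀ x y : ℝ, x + ε⁻¹ * y = ε⁻¹ * (ε * x + y) := fun x y => by field_simp
  have hpos : 0 < ε⁻¹ := inv_pos.2 hε
  have := hp i j
  simp only [hf i j hj, hf i _ (ha i), zero_add] at this
  simp only [dotp_smul_right, scale, Subtype.mk.injEq]
  exact ⟨(mul_le_mul_iff_right₀ hpos).2 this.1, (mul_right_inj' hpos.ne').trans this.2⟩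

/-- If `f` vanishes off `I` and is negative on `I`, a mixed cell of the restrictions to the
complement of `I` is a mixed cell for the lifts `f + ε • ω` for all small positive `ε`. -/
theorem IsMixedCell.eventually_extend {n : ℕ} {ι : Fin n → Type} [∀ i, Finite (ι i)]
    {A : ∀ i, ι i → Fin n → ℝ} {f ω : ∀ i, ι i → ℝ} {I : ∀ i, Set (ι i)}
    (hf : ∀ i, ∀ j ∉ I i, f i j = 0) (hfI : ∀ i, ∀ j ∈ I i, f i j < 0)
    {a b : ∀ i, ι i} (ha : ∀ i, a i ∉ I i) (hb : ∀ i, b i ∉ I i)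
    (h : IsMixedCell (ι := fun i => {j : ι i // j ∉ I i}) (fun i j => A i j.1)
      (fun i j => ω i j.1) (fun i => ⟨a i, ha i⟩) (fun i => ⟨b i, hb i⟩)) :
    ∀ᶠ ε : ℝ in nhdsWithin 0 (Set.Ioi 0), IsMixedCell A (fun i j => f i j + ε * ω i j) a b := by
  obtain ⟨hne, hli, p, hp⟩ := h
  have small : ∀ᶠ ε : ℝ in nhdsWithin 0 (Set.Ioi 0), ∀ i, ∀ j ∈ I i,
      f i j + ε * (ω i j + dotp n (A i j) p) < ε * (ω i (a i) + dotp n (A i (a i)) p) := by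
    refine Filter.eventually_all.2 fun i => Filter.eventually_all.2 fun j => ?_
    by_cases hj : j ∈ I i
    · refine (Filter.Eventually.filter_mono nhdsWithin_le_nhds ?_).mono fun _ h _ => h
      exact ContinuousAt.eventually_lt (by fun_prop) (by fun_prop) (by simpa using hfI i j hj)
    · exact Filter.Eventually.of_forall fun _ h => absurd h hj
  filter_upwards [small, self_mem_nhdsWithin] with ε hsmall hε
  have hε : 0 < ε := hε
  refine ⟨fun i hi => hne i (Subtype.ext hi), hli, ε • p, fun i j => ?_⟩
  simp only [dotp_smul_right, hf i _ (ha i), zero_add, add_assoc, ← mul_add]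
  by_cases hj : j ∈ I i
  · have hlt := hsmall i j hj
    refine ⟨hlt.le, iff_of_false hlt.ne ?_⟩
    rintro (rfl | rfl)
    · exact ha i hj
    · exact hb i hj
  · have := hp i ⟨j, hj⟩
    simp only [Subtype.mk.injEq] at this
    simp only [hf i j hj, zero_add]
    exact ⟨(mul_le_mul_iff_right₀ hε).2 this.1, (mul_right_inj' hε.ne').trans this.2⟩

/-- breaking-off lemma. Lifting the columns indexed by `𝓘ᵢ` by `−1`
and everything by `ε·ωᵢ`, for all sufficiently small `ε > 0` the mixed cells
avoiding the `𝓘ᵢ` are exactly the mixed cells of the restricted configurations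
with respect to the restricted lifts `ωᵢ`. -/
theorem breaking_off (n : ℕ) (m : Fin n → ℕ)
    (A : ∀ i : Fin n, Fin (m i) → Fin n → ℤ) (ω : ∀ i : Fin n, Fin (m i) → ℝ)
    (I : ∀ i : Fin n, Finset (Fin (m i))) :
    ∃ ε₀ > 0, ∀ ε : ℝ, 0 < ε → ε < ε₀ →
      ∀ (a b : ∀ i, Fin (m i)) (ha : ∀ i, a i ∉ I i) (hb : ∀ i, b i ∉ I i),
        IsMixedCell (fun i j l => ((A i j l : ℝ)))
            (fun i j => (if j ∈ I i then (-1 : ℝ) else 0) + ε * ω i j) a b ↔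
          IsMixedCell (ι := fun i => {j : Fin (m i) // j ∉ I i})
            (fun i j l => ((A i j.1 l : ℝ))) (fun i j => ω i j.1)
            (fun i => ⟨a i, ha i⟩) (fun i => ⟨b i, hb i⟩) := by
  have hf : ∀ i, ∀ j ∉ (I i : Set (Fin (m i))), (if j ∈ I i then (-1 : ℝ) else 0) = 0 :=
    fun i j hj => if_neg hj
  have hfI : ∀ i, ∀ j ∈ (I i : Set (Fin (m i))), (if j ∈ I i then (-1 : ℝ) else 0) < 0 :=
    fun i j hj => by rw [if_pos (Finset.mem_coe.1 hj)]; norm_num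
  have extend : ∀ᶠ ε : ℝ in nhdsWithin 0 (Set.Ioi 0), ∀ (a b : ∀ i, Fin (m i)) (ha : ∀ i, a i ∉ I i)
      (hb : ∀ i, b i ∉ I i),
      IsMixedCell (ι := fun i => {j : Fin (m i) // j ∉ I i})
        (fun i j l => ((A i j.1 l : ℝ))) (fun i j => ω i j.1)
        (fun i => ⟨a i, ha i⟩) (fun i => ⟨b i, hb i⟩) →
      IsMixedCell (fun i j l => ((A i j l : ℝ)))
        (fun i j => (if j ∈ I i then (-1 : ℝ) else 0) + ε * ω i j) a b := by
    simp only [Filter.eventually_all]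
    exact fun a b ha hb h => IsMixedCell.eventually_extend
      (A := fun i j l => (A i j l : ℝ)) (I := fun i => (I i : Set (Fin (m i)))) hf hfI ha hb h
  obtain ⟨ε₀, hε₀, hext⟩ := mem_nhdsGT_iff_exists_Ioo_subset.1 extend
  refine ⟨ε₀, hε₀, fun ε hε hlt a b ha hb => ⟨fun h => ?_, hext ⟨hε, hlt⟩ a b ha hb⟩⟩
  exact IsMixedCell.restrict (A := fun i j l => (A i j l : ℝ))
    (I := fun i => (I i : Set (Fin (m i)))) hf hε ha hb h
end

section
/- Let n ≥ 1 and for i = 1, …, n let A_i : Fin (n+1) → ℝ^n be given by A_i 0 = 0 and A_i j = e_j for j = 1, …, n, where e_j is the j-th standard basis vector of ℝ^n. For ε > 0 define lifts ω_i(ε) : Fin (n+1) → ℝ by ω_i(ε) j = ε^{(i−1)(n+1)+j}. Then there exists ε_0 > 0 such that for all ε with 0 < ε < ε_0, the tuple M with M_i = (i−1, i) for each i (i.e., configuration i contributes the pair of points e_{i−1} and e_i, with the convention e_0 := 0) is a mixed cell of (A_1, …, A_n) with respect to (ω_1(ε), …, ω_n(ε)), and it is the unique mixed cell (up to swapping the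 two entries within each pair). -/
open Pointwise MeasureTheory

/-- The standard simplex configuration in `ℝⁿ`: column `0` is the origin and
column `j` (for `1 ≤ j ≤ n`) is the `j`-th standard basis vector `e_j`. -/
def simplexConf (n : ℕ) : Fin (n + 1) → Fin n → ℝ :=
  fun j l => if (l : ℕ) + 1 = (j : ℕ) then 1 else 0

theorem dotp_simplexConf_zero {n : ℕ} (p : Fin n → ℝ) : dotp n (simplexConf n 0) p = 0 := by
  simp [dotp, simplexConf]

theorem dotp_simplexConf_succ {n : ℕ} (p : Fin n → ℝ) (l : Fin n) :
    dotp n (simplexConf n l.succ) p = p l := by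
  simp [dotp, simplexConf, ← Fin.ext_iff]

/-- A functional given by the increments of a function `q` on `ℕ` takes the value `q j` at the
`j`-th point of the simplex. -/
theorem dotp_simplexConf_of_nat {n : ℕ} {q : ℕ → ℝ} (hq : q 0 = 0) (j : Fin (n + 1)) :
    dotp n (simplexConf n j) (fun l => q (l + 1)) = q j := by
  cases j using Fin.cases with
  | zero => simp [dotp_simplexConf_zero, hq]
  | succ l => simp [dotp_simplexConf_succ]

theorem linearIndependent_simplexConf_succ_sub_castSucc (n : ℕ) :
    LinearIndependent ℝ
      (fun i : Fin n => simplexConf n i.succ - simplexConf n i.castSucc) := by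
  rw [Fintype.linearIndependent_iff]
  intro c hc k
  let q : ℕ → ℝ := fun j => if (k : ℕ) < j then 1 else 0
  have hdual (i : Fin n) : (simplexConf n i.succ - simplexConf n i.castSucc) ⬝ᵥ
      (fun l : Fin n => q (l + 1)) = if i = k then 1 else 0 := by
    have hdot (j : Fin (n + 1)) : simplexConf n j ⬝ᵥ (fun l : Fin n => q (l + 1)) = q j :=
      dotp_simplexConf_of_nat (q := q) (by simp [q]) j
    rw [sub_dotProduct, hdot, hdot]
    simp only [q, Fin.val_succ, Fin.val_castSucc, Fin.ext_iff]
    split_ifs <;> first | omega | norm_num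
  have h := congrArg (fun v => v ⬝ᵥ (fun l : Fin n => q (l + 1))) hc
  simpa [sum_dotProduct, smul_dotProduct, hdual] using h

/-- A sequence increasing strictly up to `i`, constant from `i` to `i + 1` and then decreasing
strictly attains its maximum exactly at `i` and `i + 1`. -/
theorem le_and_eq_iff_of_unimodal {G : ℕ → ℝ} {i : ℕ} (hlt : ∀ j < i, G j < G (j + 1))
    (heq : G (i + 1) = G i) (hgt : ∀ j, i < j → G (j + 1) < G j) (j : ℕ) :
    G j ≤ G i ∧ (G j = G i ↔ j = i ∨ j = i + 1) := by
  have hleft : ∀ j < i, G j < G i := fun j hj =>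
    Nat.decreasingInduction' (P := fun j => j < i → G j < G i)
      (fun k hk _ ih _ => by
        rcases (Nat.succ_le_of_lt hk).lt_or_eq with h | h
        · exact (hlt k hk).trans (ih h)
        · exact h ▸ hlt k hk) hj.le (fun h => absurd h (lt_irrefl _)) hj
  have hright : ∀ j, i + 2 ≤ j → G j < G i := by
    intro j hj
    induction j, hj using Nat.le_induction with
    | base => exact (hgt (i + 1) (by omega)).trans_eq heq
    | succ k hk ih => exact (hgt k (by omega)).trans ih
  rcases lt_or_ge j i with h | h
  · exact ⟨(hleft j h).le, iff_of_false (hleft j h).ne (by omega)⟩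
  rcases le_or_gt (i + 2) j with h' | h'
  · exact ⟨(hright j h').le, iff_of_false (hright j h').ne (by omega)⟩
  obtain rfl | rfl : j = i ∨ j = i + 1 := by omega
  · simp
  · simp [heq]

theorem isMixedCell_castSucc_succ (n : ℕ) {ε : ℝ} (h₀ : 0 < ε) (h₁ : ε < 1) :
    IsMixedCell (fun _ : Fin n => simplexConf n)
      (fun i j => ε ^ ((i : ℕ) * (n + 1) + (j : ℕ)))
      (fun i => i.castSucc) (fun i => i.succ) := by
  refine ⟨fun i => (Fin.castSucc_lt_succ).ne,
    linearIndependent_simplexConf_succ_sub_castSucc n, ?_⟩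
  let q : ℕ → ℝ := fun j => ∑ k ∈ Finset.range j, ε ^ (k * (n + 2)) * (1 - ε)
  refine ⟨fun l => q (l + 1), fun i j => ?_⟩
  simp only [dotp_simplexConf_of_nat (q := q) (by simp [q])]
  let G : ℕ → ℝ := fun j => ε ^ ((i : ℕ) * (n + 1) + j) + q j
  have hstep (j : ℕ) : G (j + 1) - G j =
      ε ^ j * (1 - ε) * (ε ^ (j * (n + 1)) - ε ^ ((i : ℕ) * (n + 1))) := by
    simp only [G, q, Finset.sum_range_succ]
    ring
  have hpos (j : ℕ) : 0 < ε ^ j * (1 - ε) := mul_pos (pow_pos h₀ j) (sub_pos.2 h₁)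
  have hpow {j k : ℕ} (h : j < k) : ε ^ (k * (n + 1)) < ε ^ (j * (n + 1)) :=
    pow_lt_pow_right_of_lt_one₀ h₀ h₁ (Nat.mul_lt_mul_of_pos_right h n.succ_pos)
  have hG := le_and_eq_iff_of_unimodal (G := G) (i := i)
    (fun j hj => sub_pos.1 (hstep j ▸ mul_pos (hpos j) (sub_pos.2 (hpow hj))))
    (sub_eq_zero.1 (by rw [hstep, sub_self, mul_zero]))
    (fun j hj => sub_neg.1 (hstep j ▸ mul_neg_of_pos_of_neg (hpos j) (sub_neg.2 (hpow hj)))) j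
  simpa [G, Fin.ext_iff] using hG

/-- Raising the base exponent from `s` to `t` moves maximizers to the right: if `j` is at least as
good as `k` for the exponent `s`, and `k` is at least as good as `j` for `t`, then `j ≤ k`. -/
theorem le_of_maximizers {ε : ℝ} (h₀ : 0 < ε) (h₁ : ε < 1) {s t j k : ℕ} (hst : s < t) {x y : ℝ}
    (hj : ε ^ (s + k) + y ≤ ε ^ (s + j) + x) (hk : ε ^ (t + j) + x ≤ ε ^ (t + k) + y) :
    j ≤ k := by
  by_contra! hkj
  have hs : ε ^ t < ε ^ s := pow_lt_pow_right_of_lt_one₀ h₀ h₁ hst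
  have hp : ε ^ j < ε ^ k := pow_lt_pow_right_of_lt_one₀ h₀ h₁ hkj
  simp only [pow_add] at hj hk
  nlinarith [mul_pos (sub_pos.2 hs) (sub_pos.2 hp)]

theorem eq_staircase_of_chain {n : ℕ} {lo hi : Fin n → ℕ} (hlt : ∀ i, lo i < hi i)
    (hle : ∀ i j, i < j → hi i ≤ lo j) (hn : ∀ i, hi i ≤ n) (i : Fin n) :
    lo i = i ∧ hi i = i + 1 := by
  have hlow : ∀ k (hk : k < n), k ≤ lo ⟨k, hk⟩ := by
    intro k
    induction k with
    | zero => intro _; exact Nat.zero_le _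
    | succ k ih =>
      intro hk
      have h₁ := ih (by omega)
      have h₂ := hlt ⟨k, by omega⟩
      have h₃ := hle ⟨k, by omega⟩ ⟨k + 1, hk⟩ (by simp [Fin.lt_def])
      omega
  have hhigh : ∀ d k (hk : k < n), k + d + 1 = n → hi ⟨k, hk⟩ ≤ k + 1 := by
    intro d
    induction d with
    | zero =>
      intro k hk hd
      have := hn ⟨k, hk⟩
      omega
    | succ d ih =>
      intro k hk hd
      have h₁ := ih (k + 1) (by omega) (by omega)
      have h₂ := hlt ⟨k + 1, by omega⟩
      have h₃ := hle ⟨k, hk⟩ ⟨k + 1, by omega⟩ (by simp [Fin.lt_def])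
      omega
  have h₁ := hlow i i.2
  have h₂ := hhigh (n - 1 - i) i i.2 (by omega)
  have h₃ := hlt i
  simp only [Fin.eta] at h₁ h₂
  omega

theorem IsMixedCell.eq_castSucc_succ {n : ℕ} {ε : ℝ} (h₀ : 0 < ε) (h₁ : ε < 1)
    {a b : ∀ _ : Fin n, Fin (n + 1)}
    (h : IsMixedCell (fun _ : Fin n => simplexConf n)
      (fun i j => ε ^ ((i : ℕ) * (n + 1) + (j : ℕ))) a b) (i : Fin n) :
    (a i = i.castSucc ∧ b i = i.succ) ∨ (a i = i.succ ∧ b i = i.castSucc) := by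
  obtain ⟨hne, -, p, hp⟩ := h
  have hmono (i j : Fin n) (hij : i < j) (x y : Fin (n + 1)) (hx : x = a i ∨ x = b i)
      (hy : y = a j ∨ y = b j) : (x : ℕ) ≤ y := by
    have hxi := ((hp i x).2.2 hx).symm ▸ (hp i y).1
    have hyj := ((hp j y).2.2 hy).symm ▸ (hp j x).1
    exact le_of_maximizers h₀ h₁ (Nat.mul_lt_mul_of_pos_right hij n.succ_pos) hxi hyj
  have hne' (i : Fin n) : (a i : ℕ) ≠ b i := fun h => hne i (Fin.ext h)
  have key := eq_staircase_of_chain (lo := fun i => min (a i : ℕ) (b i))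
    (hi := fun i => max (a i : ℕ) (b i)) (fun i => by have := hne' i; grind)
    (fun i j hij => max_le
      (le_min (hmono i j hij _ _ (.inl rfl) (.inl rfl)) (hmono i j hij _ _ (.inl rfl) (.inr rfl)))
      (le_min (hmono i j hij _ _ (.inr rfl) (.inl rfl)) (hmono i j hij _ _ (.inr rfl) (.inr rfl))))
    (fun i => max_le (Nat.le_of_lt_succ (a i).2) (Nat.le_of_lt_succ (b i).2)) i
  simp only [Fin.ext_iff, Fin.val_castSucc, Fin.val_succ]
  grind

/-- for `n` copies of the standard simplex configuration with the
lexicographic lifts `ωᵢ(ε) j = ε^{(i−1)(n+1)+j}` (here `i` runs over `Fin n`, so the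
exponent is `i(n+1)+j` with `0`-based `i`), for all sufficiently small `ε > 0`
the staircase tuple `Mᵢ = (i−1, i)`, i.e. columns `(i.castSucc, i.succ)`, is a
mixed cell, and it is the unique one up to swapping entries in each pair. -/
theorem lex_start_system_unique_mixed_cell (n : ℕ) (hn : 1 ≤ n) :
    ∃ ε₀ > 0, ∀ ε : ℝ, 0 < ε → ε < ε₀ →
      IsMixedCell (fun _ : Fin n => simplexConf n)
          (fun i j => ε ^ ((i : ℕ) * (n + 1) + (j : ℕ)))
          (fun i => i.castSucc) (fun i => i.succ) ∧
        ∀ a b : ∀ _ : Fin n, Fin (n + 1),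
          IsMixedCell (fun _ : Fin n => simplexConf n)
              (fun i j => ε ^ ((i : ℕ) * (n + 1) + (j : ℕ))) a b →
            ∀ i, (a i = i.castSucc ∧ b i = i.succ) ∨ (a i = i.succ ∧ b i = i.castSucc) := by
  exact ⟨1, one_pos, fun ε h₀ h₁ =>
    ⟨isMixedCell_castSucc_succ n h₀ h₁, fun _ _ h => h.eq_castSucc_succ h₀ h₁⟩⟩
end

section
/- Let n ≥ 2, let A_i : Fin m_i → ℤ^n for i = 1, …, n−1, and assume that the Minkowski sum conv(range A_1) + ⋯ + conv(range A_{n−1}) is full-dimensional in ℝ^n. Then for Lebesgue-almost every ω = (ω_1, …, ω_{n−1}) ∈ ℝ^{m_1} × ⋯ × ℝ^{m_{n−1}}, the number of tuples of unordered pairs ({a_1,b_1}, …, {a_{n−1},b_{n−1}}), with a_i ≠ b_i ∈ Fin m_i, such that (i) the n−1 vectors A_i b_i − A_i a_i are linearly independent over ℝ, and (ii) there exists p ∈ ℝ^n with, for every i and every j ∈ Fin m_i, ω_i j + ⟪A_i j, p⟫ ≤ ω_i a_i + ⟪A_i a_i, p⟫ with equality if and only if j ∈ {a_i, b_i}, is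 at most 3 · n! · MV(conv(range A_1), …, conv(range A_{n−1}), conv(range A_1) + ⋯ + conv(range A_{n−1})). (Such tuples are exactly the edges of the common refinement of the n−1 tropical hypersurfaces T(A_i, ω_i).) -/
open Pointwise MeasureTheory

/-- The mixed volume of `n` compact convex bodies in `ℝⁿ`, via
inclusion–exclusion on volumes of Minkowski sums. -/
noncomputable def mixedVol (n : ℕ) (C : Fin n → Set (Fin n → ℝ)) : ℝ :=
  ∑ S : Finset (Fin n), (-1 : ℝ) ^ (n - S.card) * (volume (∑ i ∈ S, C i)).toReal

/-- A configuration of integer vectors viewed over `ℝ`. -/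
def coeConf {n m : ℕ} (A : Fin m → Fin n → ℤ) : Fin m → Fin n → ℝ :=
  fun j l => (A j l : ℝ)

namespace TropicalRefinement

open scoped Matrix

section Cells

set_option linter.unusedSectionVars false

variable {ι : Type*} [Fintype ι] {J : ι → Type*} [∀ i, Fintype (J i)] {n : ℕ}

/-- The value at `p` of the affine function with slope `B i j` and constant term `ω i j`. -/
def liftVal (B : ∀ i, J i → Fin n → ℝ) (ω : ∀ i, J i → ℝ) (p : Fin n → ℝ) (i : ι) (j : J i) : ℝ :=
  ω i j + B i j ⬝ᵥ p

open Classical in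
/-- The indices attaining the `i`-th tropical polynomial at `p`. -/
noncomputable def active (B : ∀ i, J i → Fin n → ℝ) (ω : ∀ i, J i → ℝ) (p : Fin n → ℝ) (i : ι) :
    Finset (J i) :=
  Finset.univ.filter fun j => ∀ l, liftVal B ω p i l ≤ liftVal B ω p i j

/-- The Minkowski sum, with weights `w`, of the convex hulls of the subconfigurations `F`. -/
def cell (B : ∀ i, J i → Fin n → ℝ) (F : ∀ i, Finset (J i)) (w : ι → ℝ) : Set (Fin n → ℝ) :=
  ∑ i, w i • convexHull ℝ (B i '' F i)

/-- The span of all differences within the subconfigurations `F`. -/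
def diffSpan (B : ∀ i, J i → Fin n → ℝ) (F : ∀ i, Finset (J i)) : Submodule ℝ (Fin n → ℝ) :=
  Submodule.span ℝ {v | ∃ i, ∃ a ∈ F i, ∃ b ∈ F i, v = B i b - B i a}

variable {B : ∀ i, J i → Fin n → ℝ} {ω : ∀ i, J i → ℝ} {F : ∀ i, Finset (J i)} {w : ι → ℝ}
  {p q x : Fin n → ℝ}

theorem mem_cell : x ∈ cell B F w ↔
    ∃ y : ι → Fin n → ℝ, (∀ i, y i ∈ convexHull ℝ (B i '' F i)) ∧ ∑ i, w i • y i = x := by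
  rw [cell, Set.mem_fintype_sum]
  constructor
  · rintro ⟨g, hg, rfl⟩
    choose y hy hyg using fun i => Set.mem_smul_set.1 (hg i)
    exact ⟨y, hy, by simp [hyg]⟩
  · rintro ⟨y, hy, rfl⟩
    exact ⟨fun i => w i • y i, fun i => Set.smul_mem_smul_set (hy i), rfl⟩

theorem mem_active {i : ι} {j : J i} :
    j ∈ active B ω p i ↔ ∀ l, liftVal B ω p i l ≤ liftVal B ω p i j := by
  simp [active]

theorem active_nonempty [∀ i, Nonempty (J i)] (i : ι) : (active B ω p i).Nonempty := by
  obtain ⟨j, -, hj⟩ := Finset.exists_max_image Finset.univ (liftVal B ω p i) Finset.univ_nonempty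
  exact ⟨j, mem_active.2 fun l => hj l (Finset.mem_univ l)⟩

theorem liftVal_eq_of_mem_active {i : ι} {j l : J i} (hj : j ∈ active B ω p i)
    (hl : l ∈ active B ω p i) : liftVal B ω p i j = liftVal B ω p i l :=
  le_antisymm (mem_active.1 hl j) (mem_active.1 hj l)

theorem convex_cell : Convex ℝ (cell B F w) :=
  convex_sum _ fun _ _ => (convex_convexHull ℝ _).smul _

theorem isCompact_cell : IsCompact (cell B F w) := by
  rw [cell]
  refine Finset.sum_induction _ IsCompact (fun _ _ h h' => h.add h') isCompact_singleton ?_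
  intro i _
  exact (((F i).finite_toSet.image (B i)).isCompact_convexHull (𝕜 := ℝ)).smul (w i)

theorem cell_mono {G : ∀ i, Finset (J i)} (h : ∀ i, F i ⊆ G i) : cell B F w ⊆ cell B G w := by
  intro x hx
  obtain ⟨y, hy, rfl⟩ := mem_cell.1 hx
  exact mem_cell.2 ⟨y, fun i => convexHull_mono
    (Set.image_mono (Finset.coe_subset.2 (h i))) (hy i), rfl⟩

theorem sub_mem_diffSpan {a : ∀ i, J i} (ha : ∀ i, a i ∈ F i) (hx : x ∈ cell B F w) :
    x - ∑ i, w i • B i (a i) ∈ diffSpan B F := by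
  obtain ⟨y, hy, rfl⟩ := mem_cell.1 hx
  rw [← Finset.sum_sub_distrib]
  refine Submodule.sum_mem _ fun i _ => ?_
  rw [← smul_sub]
  refine Submodule.smul_mem _ _ ?_
  have hconv : Convex ℝ {z | z - B i (a i) ∈ diffSpan B F} := by
    have := (diffSpan B F).convex.translate_preimage_left (-B i (a i))
    simpa [Set.preimage, sub_eq_add_neg] using this
  refine convexHull_min ?_ hconv (hy i)
  rintro _ ⟨j, hj, rfl⟩
  exact Submodule.subset_span ⟨i, a i, ha i, j, hj, rfl⟩

theorem volume_cell_eq_zero (hne : ∀ i, (F i).Nonempty) (h : diffSpan B F ≠ ⊤) :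
    volume (cell B F w) = 0 := by
  choose a ha using hne
  refine measure_mono_null (t := (fun x => x + -∑ i, w i • B i (a i)) ⁻¹' (diffSpan B F : Set _))
    (fun x hx => ?_) ?_
  · have := sub_mem_diffSpan ha hx
    rwa [sub_eq_add_neg] at this
  · rw [measure_preimage_add_right]
    exact Measure.addHaar_submodule _ _ h

theorem volume_hyperplane {E : Type*} [NormedAddCommGroup E] [NormedSpace ℝ E] [MeasurableSpace E]
    [BorelSpace E] [FiniteDimensional ℝ E] (μ : Measure E) [μ.IsAddHaarMeasure]
    {f : E →ₗ[ℝ] ℝ} (hf : f ≠ 0) (c : ℝ) : μ {x | f x = c} = 0 := by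
  by_cases h : ∃ x₀, f x₀ = c
  · obtain ⟨x₀, rfl⟩ := h
    have : {x | f x = f x₀} = (fun x => x + -x₀) ⁻¹' (LinearMap.ker f : Set E) := by
      ext x
      simp [← sub_eq_add_neg, sub_eq_zero]
    rw [this, measure_preimage_add_right]
    refine Measure.addHaar_submodule _ _ fun h => hf (LinearMap.ker_eq_top.1 h)
  · have : {x | f x = c} = ∅ := Set.eq_empty_of_forall_notMem fun x hx => h ⟨x, hx⟩
    simp [this]

theorem finite_vertices [∀ i, Nonempty (J i)] (B : ∀ i, J i → Fin n → ℝ) (ω : ∀ i, J i → ℝ) :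
    {p | diffSpan B (active B ω p) = ⊤}.Finite := by
  classical
  refine Set.Finite.of_finite_image (f := active B ω) (Set.toFinite _) ?_
  intro p hp q hq hpq
  rw [Set.mem_ofPred_eq] at hp
  have hker : diffSpan B (active B ω p) ≤
      LinearMap.ker ((dotProductBilin ℝ ℝ).flip (p - q) : (Fin n → ℝ) →ₗ[ℝ] ℝ) := by
    refine Submodule.span_le.2 ?_
    rintro _ ⟨i, a, ha, b, hb, rfl⟩
    have h1 := liftVal_eq_of_mem_active ha hb
    rw [hpq] at ha hb
    have h2 := liftVal_eq_of_mem_active ha hb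
    simp only [liftVal] at h1 h2
    simp
    linarith
  rw [hp] at hker
  have : (p - q) ⬝ᵥ (p - q) = 0 := by
    have := hker (Submodule.mem_top (x := p - q))
    simpa using this
  exact sub_eq_zero.1 (dotProduct_self_eq_zero.1 this)

/-- The `i`-th tropical polynomial. -/
noncomputable def tropMax [∀ i, Nonempty (J i)] (B : ∀ i, J i → Fin n → ℝ) (ω : ∀ i, J i → ℝ)
    (p : Fin n → ℝ) (i : ι) : ℝ :=
  Finset.univ.sup' Finset.univ_nonempty (liftVal B ω p i)

section Nonempty

variable [∀ i, Nonempty (J i)]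

theorem liftVal_le_tropMax {i : ι} (j : J i) : liftVal B ω p i j ≤ tropMax B ω p i :=
  Finset.le_sup' _ (Finset.mem_univ j)

theorem tropMax_eq {i : ι} {j : J i} (hj : j ∈ active B ω p i) :
    tropMax B ω p i = liftVal B ω p i j :=
  le_antisymm (Finset.sup'_le _ _ fun l _ => mem_active.1 hj l) (liftVal_le_tropMax j)

theorem continuous_tropMax (i : ι) : Continuous fun p => tropMax B ω p i := by
  unfold tropMax
  refine Continuous.finset_sup'_apply _ fun j _ => ?_
  unfold liftVal
  fun_prop

theorem convex_dotProduct_le (p : Fin n → ℝ) (c : ℝ) : Convex ℝ {y : Fin n → ℝ | y ⬝ᵥ p ≤ c} :=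
  convex_halfSpace_le (f := fun y : Fin n → ℝ => y ⬝ᵥ p)
    ⟨fun _ _ => add_dotProduct _ _ _, fun _ _ => smul_dotProduct _ _ _⟩ c

/-- Points of the cell of `p` are subgradients at `p` of the weighted sum of the tropical
polynomials. -/
theorem subgradient_of_mem_cell (hw : ∀ i, 0 ≤ w i) (hx : x ∈ cell B (active B ω p) w)
    (q : Fin n → ℝ) :
    ∑ i, w i * tropMax B ω p i + x ⬝ᵥ (q - p) ≤ ∑ i, w i * tropMax B ω q i := by
  obtain ⟨y, hy, rfl⟩ := mem_cell.1 hx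
  rw [sum_dotProduct, ← Finset.sum_add_distrib]
  refine Finset.sum_le_sum fun i _ => ?_
  rw [smul_dotProduct, smul_eq_mul, ← mul_add]
  refine mul_le_mul_of_nonneg_left ?_ (hw i)
  have : y i ∈ {y : Fin n → ℝ | y ⬝ᵥ (q - p) ≤ tropMax B ω q i - tropMax B ω p i} := by
    refine convexHull_min ?_ (convex_dotProduct_le _ _) (hy i)
    rintro _ ⟨j, hj, rfl⟩
    have h1 := liftVal_le_tropMax (B := B) (ω := ω) (p := q) j
    rw [Set.mem_ofPred_eq, tropMax_eq hj, dotProduct_sub]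
    simp only [liftVal] at h1 ⊢
    linarith
  rw [Set.mem_ofPred_eq] at this
  linarith

theorem volume_cell_inter (hw : ∀ i, 0 ≤ w i) (hpq : p ≠ q) :
    volume (cell B (active B ω p) w ∩ cell B (active B ω q) w) = 0 := by
  have hf : ((dotProductBilin ℝ ℝ).flip (q - p) : (Fin n → ℝ) →ₗ[ℝ] ℝ) ≠ 0 := by
    intro h
    have := LinearMap.congr_fun h (q - p)
    simp only [LinearMap.flip_apply, dotProductBilin_apply_apply, LinearMap.zero_apply] at this
    exact hpq (sub_eq_zero.1 (dotProduct_self_eq_zero.1 this)).symm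
  refine measure_mono_null ?_ (volume_hyperplane volume hf
    (∑ i, w i * tropMax B ω q i - ∑ i, w i * tropMax B ω p i))
  rintro x ⟨hxp, hxq⟩
  have h1 := subgradient_of_mem_cell hw hxp q
  have h2 := subgradient_of_mem_cell hw hxq p
  simp only [dotProduct_sub] at h1 h2
  simp
  linarith

/-- A minimizer of the weighted sum of the tropical polynomials minus the linear form `x` has `x`
in its cell. -/
theorem mem_cell_of_isMin
    (hmin : ∀ q, ∑ i, w i * tropMax B ω p i - x ⬝ᵥ p ≤ ∑ i, w i * tropMax B ω q i - x ⬝ᵥ q) :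
    x ∈ cell B (active B ω p) w := by
  by_contra hx
  obtain ⟨f, u, hfu, hux⟩ := geometric_hahn_banach_closed_point convex_cell
    isCompact_cell.isClosed hx
  set v : Fin n → ℝ := fun l => f (Pi.single l 1) with hv
  have hfv : ∀ y, f y = y ⬝ᵥ v := by
    intro y
    conv_lhs => rw [pi_eq_sum_univ' y]
    simp [dotProduct, hv]
  have hev : ∀ᶠ t : ℝ in nhdsWithin 0 (Set.Ioi 0), ∀ i, ∀ j, j ∉ active B ω p i →
      liftVal B ω (p + t • v) i j < tropMax B ω (p + t • v) i := by
    refine nhdsWithin_le_nhds ?_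
    refine Filter.eventually_all.2 fun i => Filter.eventually_all.2 fun j => ?_
    by_cases hj : j ∈ active B ω p i
    · simp [hj]
    obtain ⟨l, hl⟩ : ∃ l, liftVal B ω p i j < liftVal B ω p i l := by
      simpa [mem_active] using hj
    have hc : ∀ j, Continuous fun t : ℝ => liftVal B ω (p + t • v) i j := by
      intro j
      unfold liftVal
      fun_prop
    have := (hc j).continuousAt.eventually_lt (x₀ := 0) (hc l).continuousAt (by simpa using hl)
    filter_upwards [this] with t ht _
    exact ht.trans_le (liftVal_le_tropMax l)
  obtain ⟨t, ht, ht0⟩ := (hev.and self_mem_nhdsWithin).exists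
  choose a ha using fun i => active_nonempty (B := B) (ω := ω) (p := p + t • v) i
  have hap : ∀ i, a i ∈ active B ω p i := by
    intro i
    by_contra h
    have := ht i (a i) h
    rw [tropMax_eq (ha i)] at this
    exact lt_irrefl _ this
  have hmem : ∑ i, w i • B i (a i) ∈ cell B (active B ω p) w :=
    mem_cell.2 ⟨fun i => B i (a i), fun i => subset_convexHull ℝ _ ⟨a i, hap i, rfl⟩, rfl⟩
  have h1 := (hfu _ hmem).trans hux
  rw [hfv, hfv] at h1
  have h2 := hmin (p + t • v)
  have h3 : ∑ i, w i * tropMax B ω (p + t • v) i =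
      ∑ i, w i * tropMax B ω p i + t * ((∑ i, w i • B i (a i)) ⬝ᵥ v) := by
    rw [sum_dotProduct, Finset.mul_sum, ← Finset.sum_add_distrib]
    refine Finset.sum_congr rfl fun i _ => ?_
    rw [tropMax_eq (ha i), tropMax_eq (hap i)]
    simp [liftVal, dotProduct_add]
    ring
  rw [h3, dotProduct_add, dotProduct_smul, smul_eq_mul] at h2
  nlinarith

theorem exists_mem_cell_active (hw : ∀ i, 0 ≤ w i)
    (hx : x ∈ interior (cell B (fun _ => Finset.univ) w)) (ω : ∀ i, J i → ℝ) :
    ∃ p, x ∈ cell B (active B ω p) w := by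
  set φ : (Fin n → ℝ) → ℝ := fun p => ∑ i, w i * tropMax B ω p i - x ⬝ᵥ p with hφ
  set C : ℝ := ∑ i, w i * Finset.univ.sup' Finset.univ_nonempty (fun j => - ω i j) with hC
  have hlow : ∀ y ∈ cell B (fun _ => Finset.univ) w, ∀ p, y ⬝ᵥ p - C ≤
      ∑ i, w i * tropMax B ω p i := by
    intro y hy p
    obtain ⟨z, hz, rfl⟩ := mem_cell.1 hy
    rw [sum_dotProduct, hC, ← Finset.sum_sub_distrib]
    refine Finset.sum_le_sum fun i _ => ?_
    rw [smul_dotProduct, smul_eq_mul, ← mul_sub]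
    refine mul_le_mul_of_nonneg_left ?_ (hw i)
    have : z i ∈ {y : Fin n → ℝ | y ⬝ᵥ p ≤ tropMax B ω p i +
        Finset.univ.sup' Finset.univ_nonempty (fun j => - ω i j)} := by
      refine convexHull_min ?_ (convex_dotProduct_le _ _) (hz i)
      rintro _ ⟨j, -, rfl⟩
      have h1 := liftVal_le_tropMax (B := B) (ω := ω) (p := p) j
      have h2 := Finset.le_sup' (fun j => - ω i j) (Finset.mem_univ j)
      simp only [liftVal] at h1
      simp only [Set.mem_ofPred_eq]
      linarith
    rw [Set.mem_ofPred_eq] at this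
    linarith
  obtain ⟨r, hr, hball⟩ := Metric.isOpen_iff.1 isOpen_interior x hx
  have hcoord : ∀ p l, r / 2 * |p l| ≤ φ p + C := by
    intro p l
    have key : ∀ s : ℝ, |s| = r / 2 → s * p l ≤ φ p + C := by
      intro s hs
      have hmem : x + Pi.single l s ∈ cell B (fun _ => Finset.univ) w := by
        refine interior_subset (hball ?_)
        rw [mem_ball_iff_norm, add_sub_cancel_left, Pi.norm_single, Real.norm_eq_abs, hs]
        linarith
      have := hlow _ hmem p
      rw [add_dotProduct, single_dotProduct] at this
      simp only [hφ]
      linarith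
    rcases abs_cases (p l) with ⟨h, -⟩ | ⟨h, -⟩
    · rw [h]
      exact key _ (abs_of_pos (by linarith))
    · rw [h]
      have := key (-(r / 2)) (by rw [abs_neg, abs_of_pos (by linarith)])
      linarith
  have hnonneg : ∀ p, 0 ≤ φ p + C := by
    intro p
    have := hlow _ (interior_subset hx) p
    simp only [hφ]
    linarith
  have hnorm : ∀ p, r / 2 * ‖p‖ - C ≤ φ p := by
    intro p
    have : ‖p‖ ≤ (φ p + C) / (r / 2) := by
      refine (pi_norm_le_iff_of_nonneg (div_nonneg (hnonneg p) (by linarith))).2 fun l => ?_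
      rw [Real.norm_eq_abs, le_div_iff₀ (by linarith), mul_comm]
      exact hcoord p l
    rw [le_div_iff₀ (by linarith)] at this
    linarith
  have hcont : Continuous φ := by
    refine Continuous.sub (continuous_finsetSum _ fun i _ => ?_) (by fun_prop)
    exact continuous_const.mul (continuous_tropMax i)
  have htend : Filter.Tendsto φ (Filter.cocompact _) Filter.atTop := by
    refine Filter.tendsto_atTop_mono hnorm ?_
    exact Filter.tendsto_atTop_add_const_right _ _
      (tendsto_norm_cocompact_atTop.const_mul_atTop (by linarith))
  obtain ⟨p, hp⟩ := hcont.exists_forall_le htend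
  exact ⟨p, mem_cell_of_isMin hp⟩

/-- The mixed subdivision induced by `ω` computes the volume of every weighted Minkowski sum. -/
theorem volume_cell_univ (hw : ∀ i, 0 ≤ w i) (ω : ∀ i, J i → ℝ) :
    volume (cell B (fun _ => Finset.univ) w) =
      ∑ p ∈ (finite_vertices B ω).toFinset, volume (cell B (active B ω p) w) := by
  classical
  have hdisj : ((finite_vertices B ω).toFinset : Set (Fin n → ℝ)).Pairwise
      (Function.onFun (AEDisjoint volume) fun p => cell B (active B ω p) w) := by
    intro p _ q _ hpq
    exact volume_cell_inter (B := B) (ω := ω) hw hpq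
  have hmeas : ∀ p ∈ (finite_vertices B ω).toFinset,
      NullMeasurableSet (cell B (active B ω p) w) volume :=
    fun p _ => isCompact_cell.isClosed.measurableSet.nullMeasurableSet
  rw [← measure_biUnion_finset₀ hdisj hmeas]
  apply le_antisymm
  · set N : Set (∀ i, Finset (J i)) := {F | (∀ i, (F i).Nonempty) ∧ diffSpan B F ≠ ⊤} with hN
    have hnull : volume (frontier (cell B (fun _ => Finset.univ) w) ∪
        ⋃ F ∈ N, cell B F w) = 0 := by
      refine measure_union_null (convex_cell.addHaar_frontier _) ?_
      exact (measure_biUnion_null_iff (Set.toFinite N).countable).2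
        fun F hF => volume_cell_eq_zero hF.1 hF.2
    have hcover : cell B (fun _ => Finset.univ) w ⊆
        (⋃ p ∈ (finite_vertices B ω).toFinset, cell B (active B ω p) w) ∪
          (frontier (cell B (fun _ => Finset.univ) w) ∪ ⋃ F ∈ N, cell B F w) := by
      intro x hx
      by_cases hxi : x ∈ interior (cell B (fun _ => Finset.univ) w)
      · obtain ⟨p, hp⟩ := exists_mem_cell_active hw hxi ω
        by_cases hV : diffSpan B (active B ω p) = ⊤
        · exact Or.inl (Set.mem_biUnion ((finite_vertices B ω).mem_toFinset.2 hV) hp)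
        · exact Or.inr (Or.inr (Set.mem_biUnion (x := active B ω p)
            (show active B ω p ∈ N from ⟨fun i => active_nonempty i, hV⟩) hp))
      · right; left
        exact ⟨subset_closure hx, hxi⟩
    calc _ ≤ _ := measure_mono hcover
      _ ≤ _ := measure_union_le _ _
      _ = _ := by rw [hnull, add_zero]
  · exact measure_mono (Set.iUnion₂_subset fun p _ => cell_mono fun i => Finset.subset_univ _)

end Nonempty

end Cells

section Generic

set_option linter.unusedSectionVars false

variable {ι : Type*} [Fintype ι] {J : ι → Type*} [∀ i, Fintype (J i)] {n : ℕ}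

/-- The coefficients `c` form an affine dependence within each subconfiguration `F i`, jointly over
all `i`. -/
def IsJointRelation (B : ∀ i, J i → Fin n → ℝ) (F : ∀ i, Finset (J i)) (c : ∀ i, J i → ℝ) : Prop :=
  (∀ i j, c i j ≠ 0 → j ∈ F i) ∧ (∀ i, ∑ j, c i j = 0) ∧ ∑ i, ∑ j, c i j • B i j = 0

/-- A lift is generic if active sets never carry a nontrivial joint affine dependence. -/
def IsGenericLift (B : ∀ i, J i → Fin n → ℝ) (ω : ∀ i, J i → ℝ) : Prop :=
  ∀ p c, IsJointRelation B (active B ω p) c → c = 0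

variable {B : ∀ i, J i → Fin n → ℝ} {ω : ∀ i, J i → ℝ} {F : ∀ i, Finset (J i)} {w : ι → ℝ}
  {p q x : Fin n → ℝ}

theorem IsJointRelation.sum_mul_eq_zero [∀ i, Nonempty (J i)] {c : ∀ i, J i → ℝ}
    (hc : IsJointRelation B (active B ω p) c) : ∑ i, ∑ j, c i j * ω i j = 0 := by
  obtain ⟨hsupp, hsum, hrel⟩ := hc
  have h1 : ∀ i j, c i j * ω i j = c i j * tropMax B ω p i - (c i j • B i j) ⬝ᵥ p := by
    intro i j
    by_cases h : c i j = 0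
    · simp [h]
    · rw [tropMax_eq (hsupp i j h), liftVal, smul_dotProduct, smul_eq_mul]
      ring
  simp_rw [h1, Finset.sum_sub_distrib, ← Finset.sum_mul, hsum, zero_mul, ← sum_dotProduct, hrel]
  simp

theorem ae_isGenericLift [∀ i, Nonempty (J i)] (B : ∀ i, J i → Fin n → ℝ) :
    ∀ᵐ ω ∂(volume : Measure (∀ i, J i → ℝ)), IsGenericLift B ω := by
  classical
  have key : ∀ F : ∀ i, Finset (J i), ∀ᵐ ω ∂(volume : Measure (∀ i, J i → ℝ)),
      (∃ p, active B ω p = F) → ∀ c, IsJointRelation B F c → c = 0 := by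
    intro F
    by_cases h : ∃ c, IsJointRelation B F c ∧ c ≠ 0
    · obtain ⟨c, hc, hc0⟩ := h
      set f : (∀ i, J i → ℝ) →ₗ[ℝ] ℝ :=
        ∑ i, ∑ j, c i j • ((LinearMap.proj j : (J i → ℝ) →ₗ[ℝ] ℝ) ∘ₗ
          (LinearMap.proj i : (∀ i, J i → ℝ) →ₗ[ℝ] (J i → ℝ))) with hf
      have hfapp : ∀ ω, f ω = ∑ i, ∑ j, c i j * ω i j := by
        intro ω
        simp [hf, LinearMap.sum_apply]
      have hf0 : f ≠ 0 := by
        intro h0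
        have h1 := hfapp c
        rw [h0, LinearMap.zero_apply] at h1
        apply hc0
        funext i j
        have h2 := (Finset.sum_eq_zero_iff_of_nonneg (fun i _ =>
          Finset.sum_nonneg fun j _ => mul_self_nonneg (c i j))).1 h1.symm i (Finset.mem_univ i)
        have h3 := (Finset.sum_eq_zero_iff_of_nonneg (fun j _ =>
          mul_self_nonneg (c i j))).1 h2 j (Finset.mem_univ j)
        exact mul_self_eq_zero.1 h3
      have h2 : ∀ᵐ ω ∂(volume : Measure (∀ i, J i → ℝ)), f ω ≠ 0 := by
        rw [ae_iff]
        simpa using volume_hyperplane volume hf0 0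
      filter_upwards [h2] with ω hω
      rintro ⟨p, rfl⟩
      exact absurd ((hfapp ω).trans hc.sum_mul_eq_zero) hω
    · push Not at h
      exact Filter.Eventually.of_forall fun _ _ => h
  filter_upwards [ae_all_iff.2 key] with ω hω p c hc
  exact hω _ ⟨p, rfl⟩ c hc

variable [∀ i, DecidableEq (J i)]

/-- The differences to a base point within each subconfiguration. -/
def diffVec (B : ∀ i, J i → Fin n → ℝ) (F : ∀ i, Finset (J i)) (a : ∀ i, J i)
    (x : Σ i, ↥((F i).erase (a i))) : Fin n → ℝ :=
  B x.1 x.2 - B x.1 (a x.1)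

theorem linearIndependent_diffVec (h : ∀ c, IsJointRelation B F c → c = 0) {a : ∀ i, J i}
    (ha : ∀ i, a i ∈ F i) : LinearIndependent ℝ (diffVec B F a) := by
  rw [Fintype.linearIndependent_iff]
  intro g hg
  set G : ∀ i, J i → ℝ := fun i j => if h : j ∈ (F i).erase (a i) then g ⟨i, j, h⟩ else 0 with hG
  have hG1 : ∀ i j (h : j ∈ (F i).erase (a i)), G i j = g ⟨i, j, h⟩ := by
    intro i j h
    simp only [hG, dif_pos h]
  have hG0 : ∀ i j, j ∉ (F i).erase (a i) → G i j = 0 := by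
    intro i j h
    simp only [hG, dif_neg h]
  set c : ∀ i, J i → ℝ := fun i j => G i j - if j = a i then ∑ l, G i l else 0 with hc
  have hc0 : c = 0 := by
    refine h c ⟨?_, ?_, ?_⟩
    · intro i j hij
      by_contra hj
      apply hij
      have h1 : j ≠ a i := fun h => hj (h ▸ ha i)
      simp [hc, h1, hG0 i j (fun h => hj (Finset.mem_of_mem_erase h))]
    · intro i
      simp [hc]
    · rw [← hg, Fintype.sum_sigma]
      refine Finset.sum_congr rfl fun i _ => ?_
      have h1 : ∑ y : ↥((F i).erase (a i)), g ⟨i, y⟩ • diffVec B F a ⟨i, y⟩ =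
          ∑ j ∈ (F i).erase (a i), G i j • (B i j - B i (a i)) := by
        rw [← Finset.sum_coe_sort ((F i).erase (a i)) fun j => G i j • (B i j - B i (a i))]
        refine Finset.sum_congr rfl fun y _ => ?_
        rw [hG1 i y y.2]
        rfl
      rw [h1, Finset.sum_subset (Finset.subset_univ ((F i).erase (a i)))
        (fun j _ hj => by rw [hG0 i j hj, zero_smul])]
      simp [hc, sub_smul, smul_sub, Finset.sum_sub_distrib, ite_smul, Finset.sum_smul]
  rintro ⟨i, j, hj⟩
  have h1 := congr_fun (congr_fun hc0 i) j
  have h2 : j ≠ a i := Finset.ne_of_mem_erase hj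
  simpa [hc, h2, hG1 i j hj] using h1

theorem span_diffVec {a : ∀ i, J i} (ha : ∀ i, a i ∈ F i) :
    Submodule.span ℝ (Set.range (diffVec B F a)) = diffSpan B F := by
  apply le_antisymm
  · refine Submodule.span_le.2 ?_
    rintro _ ⟨⟨i, j, hj⟩, rfl⟩
    exact Submodule.subset_span ⟨i, a i, ha i, j, Finset.mem_of_mem_erase hj, rfl⟩
  · refine Submodule.span_le.2 ?_
    have hmem : ∀ i, ∀ j ∈ F i, B i j - B i (a i) ∈
        Submodule.span ℝ (Set.range (diffVec B F a)) := by
      intro i j hj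
      by_cases h : j = a i
      · simp [h]
      · exact Submodule.subset_span ⟨⟨i, j, Finset.mem_erase.2 ⟨h, hj⟩⟩, rfl⟩
    rintro _ ⟨i, b, hb, d, hd, rfl⟩
    have := Submodule.sub_mem _ (hmem i d hd) (hmem i b hb)
    simpa using this

/-- The volume of a fine mixed cell is homogeneous in each weight separately. -/
theorem volume_cell_eq_prod_mul (h : ∀ c, IsJointRelation B F c → c = 0)
    (hne : ∀ i, (F i).Nonempty) (hspan : diffSpan B F = ⊤) (hw : ∀ i, 0 ≤ w i) :
    (volume (cell B F w)).toReal =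
      (∏ i, w i ^ ((F i).card - 1)) * (volume (cell B F 1)).toReal := by
  classical
  choose a ha using hne
  let b : Module.Basis (Σ i, ↥((F i).erase (a i))) ℝ (Fin n → ℝ) :=
    Module.Basis.mk (linearIndependent_diffVec h ha) (by rw [span_diffVec ha, hspan])
  have hb : ∀ x, b x = diffVec B F a x := fun x => Module.Basis.mk_apply _ _ x
  let D : (Fin n → ℝ) →ₗ[ℝ] (Fin n → ℝ) :=
    Matrix.toLin b b (Matrix.diagonal fun x => w x.1)
  have hDdet : LinearMap.det D = ∏ i, w i ^ ((F i).card - 1) := by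
    rw [LinearMap.det_toLin, Matrix.det_diagonal, Fintype.prod_sigma]
    refine Finset.prod_congr rfl fun i _ => ?_
    dsimp only
    rw [Finset.prod_const, Finset.card_univ, Fintype.card_coe, Finset.card_erase_of_mem (ha i)]
  have hDb : ∀ x, D (b x) = w x.1 • b x := by
    intro x
    rw [Matrix.toLin_self, Finset.sum_eq_single x]
    · simp
    · intro y _ hy
      simp [hy]
    · simp
  have hD : ∀ i, ∀ y ∈ convexHull ℝ (B i '' F i), D (y - B i (a i)) = w i • (y - B i (a i)) := by
    intro i y hy
    have hconv : Convex ℝ {y | y - B i (a i) ∈ LinearMap.ker (D - w i • LinearMap.id)} := by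
      have := (LinearMap.ker (D - w i • LinearMap.id)).convex.translate_preimage_left (-B i (a i))
      simpa [Set.preimage, sub_eq_add_neg] using this
    have hmem : y ∈ {y | y - B i (a i) ∈ LinearMap.ker (D - w i • LinearMap.id)} := by
      refine convexHull_min ?_ hconv hy
      rintro _ ⟨j, hj, rfl⟩
      by_cases hja : j = a i
      · simp [hja]
      · have := hDb ⟨i, j, Finset.mem_erase.2 ⟨hja, hj⟩⟩
        rw [hb] at this
        rw [Set.mem_ofPred_eq, LinearMap.mem_ker, LinearMap.sub_apply, sub_eq_zero]
        exact this
    rw [Set.mem_ofPred_eq, LinearMap.mem_ker, LinearMap.sub_apply, sub_eq_zero] at hmem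
    exact hmem
  set v : Fin n → ℝ := ∑ i, w i • B i (a i) - D (∑ i, B i (a i)) with hv
  have hkey : ∀ y : ι → Fin n → ℝ, (∀ i, y i ∈ convexHull ℝ (B i '' F i)) →
      v + D (∑ i, y i) = ∑ i, w i • y i := by
    intro y hy
    have h1 : D (∑ i, (y i - B i (a i))) = ∑ i, w i • (y i - B i (a i)) := by
      rw [map_sum]
      exact Finset.sum_congr rfl fun i _ => hD i _ (hy i)
    simp only [Finset.sum_sub_distrib, map_sub, smul_sub] at h1
    rw [hv, sub_add_eq_add_sub, add_sub_assoc, h1]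
    abel
  have himage : cell B F w = (fun x => v + x) '' (D '' cell B F 1) := by
    ext x
    rw [Set.image_image]
    constructor
    · intro hx
      obtain ⟨y, hy, rfl⟩ := mem_cell.1 hx
      exact ⟨∑ i, y i, mem_cell.2 ⟨y, hy, by simp⟩, hkey y hy⟩
    · rintro ⟨z, hz, rfl⟩
      obtain ⟨y, hy, rfl⟩ := mem_cell.1 hz
      refine mem_cell.2 ⟨y, hy, ?_⟩
      simp only [Pi.one_apply, one_smul]
      exact (hkey y hy).symm
  rw [himage, Set.image_add_left, measure_preimage_add, Measure.addHaar_image_linearMap, hDdet,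
    ENNReal.toReal_mul, ENNReal.toReal_ofReal (abs_nonneg _), abs_of_nonneg]
  exact Finset.prod_nonneg fun i _ => pow_nonneg (hw i) _

theorem card_sum_eq (h : ∀ c, IsJointRelation B F c → c = 0)
    (hne : ∀ i, (F i).Nonempty) (hspan : diffSpan B F = ⊤) :
    ∑ i, ((F i).card - 1) = n := by
  choose a ha using hne
  let b : Module.Basis (Σ i, ↥((F i).erase (a i))) ℝ (Fin n → ℝ) :=
    Module.Basis.mk (linearIndependent_diffVec h ha) (by rw [span_diffVec ha, hspan])
  have := Module.finrank_eq_card_basis b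
  rw [Module.finrank_fin_fun, Fintype.card_sigma] at this
  rw [this]
  refine Finset.sum_congr rfl fun i _ => ?_
  rw [Fintype.card_coe, Finset.card_erase_of_mem (ha i)]

theorem _root_.Convex.add_sum_smul_mem {E κ : Type*} [AddCommGroup E] [Module ℝ E] [Fintype κ]
    {s : Set E} (hs : Convex ℝ s) {a : E} (ha : a ∈ s) {v : κ → E} (hv : ∀ j, a + v j ∈ s)
    {t : κ → ℝ} (ht : ∀ j, 0 ≤ t j) (ht1 : ∑ j, t j ≤ 1) : a + ∑ j, t j • v j ∈ s := by
  have := hs.sum_mem (t := Finset.univ) (w := fun o : Option κ => o.elim (1 - ∑ j, t j) t)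
    (z := fun o => o.elim a fun j => a + v j)
    (by rintro (_ | j) _ <;> simp [ht, ht1]) (by simp [Fintype.sum_option])
    (by rintro (_ | j) _ <;> simp [ha, hv])
  simp only [Fintype.sum_option, Option.elim_none, Option.elim_some, smul_add,
    Finset.sum_add_distrib, ← Finset.sum_smul] at this
  convert this using 1
  rw [← add_assoc, ← add_smul]
  simp

/-- A full-dimensional fine mixed cell of integer points all of whose factors have dimension at
most two has volume at least `2⁻ⁿ`. -/
theorem le_volume_cell {A : ∀ i, J i → Fin n → ℤ} (hB : ∀ i j l, B i j l = A i j l)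
    (h : ∀ c, IsJointRelation B F c → c = 0) (hne : ∀ i, (F i).Nonempty)
    (hspan : diffSpan B F = ⊤) (hcard : ∀ i, (F i).card ≤ 3) :
    (1 / 2 : ℝ) ^ n ≤ (volume (cell B F 1)).toReal := by
  choose a ha using hne
  have hli := linearIndependent_diffVec h ha
  let b : Module.Basis (Σ i, ↥((F i).erase (a i))) ℝ (Fin n → ℝ) :=
    Module.Basis.mk hli (by rw [span_diffVec ha, hspan])
  have hcardn : Fintype.card (Σ i, ↥((F i).erase (a i))) = Fintype.card (Fin n) := by
    rw [← Module.finrank_eq_card_basis b, Module.finrank_fin_fun, Fintype.card_fin]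
  let e := Fintype.equivOfCardEq hcardn
  let M : Matrix (Fin n) (Fin n) ℤ :=
    Matrix.of fun l => A (e.symm l).1 (e.symm l).2 - A (e.symm l).1 (a (e.symm l).1)
  let MR : Matrix (Fin n) (Fin n) ℝ := M.map fun x => (x : ℝ)
  have hMR : ∀ l, MR l = diffVec B F a (e.symm l) := by
    intro l
    ext r
    simp [MR, M, diffVec, hB]
  have hdet : 1 ≤ |MR.det| := by
    have h1 : MR.det = ((M.det : ℤ) : ℝ) := (Int.cast_det M).symm
    have h2 : MR.det ≠ 0 := by
      have : LinearIndependent ℝ (fun l => MR l) := by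
        simp_rw [hMR]
        exact hli.comp _ e.symm.injective
      have := (Matrix.linearIndependent_rows_iff_isUnit (A := MR)).1 this
      exact ((Matrix.isUnit_iff_isUnit_det _).1 this).ne_zero
    rw [h1] at h2 ⊢
    have h3 : M.det ≠ 0 := by exact_mod_cast h2
    exact_mod_cast Int.one_le_abs h3
  let T : (Fin n → ℝ) →ₗ[ℝ] (Fin n → ℝ) := Matrix.toLin' MRᵀ
  have hT : ∀ t, T t = ∑ x, t (e x) • diffVec B F a x := by
    intro t
    rw [← e.symm.sum_comp]
    simp only [Equiv.apply_symm_apply, ← hMR]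
    ext r
    simp [T, Matrix.mulVec, dotProduct, mul_comm]
  have hTdet : LinearMap.det T = MR.det := by
    rw [LinearMap.det_toLin', Matrix.det_transpose]
  set v : Fin n → ℝ := ∑ i, B i (a i)
  have hsub : (fun x => v + x) '' (T '' Set.Icc 0 (fun _ => 1 / 2)) ⊆ cell B F 1 := by
    rintro _ ⟨_, ⟨t, ht, rfl⟩, rfl⟩
    refine mem_cell.2 ⟨fun i => B i (a i) +
      ∑ y : ↥((F i).erase (a i)), t (e ⟨i, y⟩) • diffVec B F a ⟨i, y⟩, fun i => ?_, ?_⟩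
    · refine (convex_convexHull ℝ _).add_sum_smul_mem ?_ ?_ (fun y => ht.1 _) ?_
      · exact subset_convexHull ℝ _ ⟨a i, ha i, rfl⟩
      · intro y
        refine subset_convexHull ℝ _ ⟨y, Finset.mem_of_mem_erase y.2, ?_⟩
        simp [diffVec]
      · refine (Finset.sum_le_card_nsmul Finset.univ (fun y => t (e ⟨i, y⟩)) (1 / 2)
          fun y _ => ht.2 _).trans ?_
        rw [Finset.card_univ, Fintype.card_coe, Finset.card_erase_of_mem (ha i), nsmul_eq_mul]
        have h1 : (F i).card - 1 ≤ 2 := by have := hcard i; omega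
        have h2 : (((F i).card - 1 : ℕ) : ℝ) ≤ 2 := by exact_mod_cast h1
        linarith
    · simp only [Pi.one_apply, one_smul, Finset.sum_add_distrib]
      rw [hT, Fintype.sum_sigma]
  have hvol : volume ((fun x => v + x) '' (T '' Set.Icc 0 (fun _ => 1 / 2))) =
      ENNReal.ofReal |MR.det| * ENNReal.ofReal ((1 / 2) ^ n) := by
    rw [Set.image_add_left, measure_preimage_add, Measure.addHaar_image_linearMap, hTdet,
      Real.volume_Icc_pi, ENNReal.ofReal_pow (by norm_num)]
    simp
  have hle := ENNReal.toReal_mono isCompact_cell.measure_lt_top.ne (measure_mono (μ := volume) hsub)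
  rw [hvol, ENNReal.toReal_mul, ENNReal.toReal_ofReal (abs_nonneg _),
    ENNReal.toReal_ofReal (by positivity)] at hle
  have : (0 : ℝ) ≤ (1 / 2) ^ n := by positivity
  nlinarith

end Generic

section MixedVolume

/-- The multiplicity of the `i`-th body in the Minkowski sum over `S` of a family whose last member
is the sum of all the others. -/
def snocWeight {k : ℕ} (S : Finset (Fin (k + 1))) (i : Fin k) : ℝ :=
  (if i.castSucc ∈ S then 1 else 0) + if Fin.last k ∈ S then 1 else 0

theorem snocWeight_nonneg {k : ℕ} (S : Finset (Fin (k + 1))) (i : Fin k) : 0 ≤ snocWeight S i := by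
  unfold snocWeight
  split_ifs <;> norm_num

theorem sum_snoc_eq_sum_smul {k : ℕ} {E : Type*} [AddCommGroup E] [Module ℝ E]
    {C : Fin k → Set E} (hC : ∀ i, Convex ℝ (C i)) (hne : ∀ i, (C i).Nonempty)
    (S : Finset (Fin (k + 1))) :
    ∑ l ∈ S, (Fin.snoc C (∑ i, C i) : Fin (k + 1) → Set E) l = ∑ i, snocWeight S i • C i := by
  have hite : ∀ (P : Prop) [Decidable P] (i : Fin k),
      (if P then C i else 0) = (if P then (1 : ℝ) else 0) • C i := by
    intro P _ i
    split_ifs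
    · rw [one_smul]
    · rw [Set.zero_smul_set (hne i)]
  have h1 : ∑ l ∈ S, (Fin.snoc C (∑ i, C i) : Fin (k + 1) → Set E) l =
      ∑ l, if l ∈ S then (Fin.snoc C (∑ i, C i) : Fin (k + 1) → Set E) l else 0 := by
    simp
  have h2 : (if Fin.last k ∈ S then ∑ i, C i else 0) =
      ∑ i, if Fin.last k ∈ S then C i else 0 := by
    split_ifs <;> simp
  rw [h1, Fin.sum_univ_castSucc]
  simp only [Fin.snoc_castSucc, Fin.snoc_last]
  rw [h2, ← Finset.sum_add_distrib]
  refine Finset.sum_congr rfl fun i _ => ?_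
  rw [hite, hite, snocWeight, (hC i).add_smul] <;> split_ifs <;> norm_num

theorem sum_sign_mul_prod_snocWeight {k : ℕ} (d : Fin k → ℕ) :
    ∑ S : Finset (Fin (k + 1)), (-1 : ℝ) ^ (k + 1 - S.card) * ∏ i, snocWeight S i ^ d i =
      ∏ i, ((2 : ℝ) ^ d i - 1) - ∏ i, (1 - (0 : ℝ) ^ d i) := by
  have hprod : ∀ (f g : Fin (k + 1) → ℝ) (S : Finset (Fin (k + 1))),
      (∏ l ∈ S, f l) * ∏ l ∈ Sᶜ, g l = ∏ l, if l ∈ S then f l else g l := by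
    intro f g S
    rw [Finset.prod_ite]
    congr 2 <;> ext <;> simp
  have hsign : ∀ S : Finset (Fin (k + 1)), (-1 : ℝ) ^ (k + 1 - S.card) =
      ∏ l, if l ∈ S then (1 : ℝ) else -1 := by
    intro S
    rw [← hprod, Finset.prod_const_one, one_mul, Finset.prod_const, Finset.card_compl,
      Fintype.card_fin]
  have h1 := Fintype.prod_add (Fin.snoc (fun i => (2 : ℝ) ^ d i) 1 : Fin (k + 1) → ℝ)
    (Fin.snoc (fun _ => (-1 : ℝ)) 0 : Fin (k + 1) → ℝ)
  have h2 := Fintype.prod_add (Fin.snoc (fun _ => (1 : ℝ)) 0 : Fin (k + 1) → ℝ)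
    (Fin.snoc (fun i => -(0 : ℝ) ^ d i) (-1) : Fin (k + 1) → ℝ)
  simp only [hprod] at h1 h2
  rw [Fin.prod_univ_castSucc] at h1 h2
  simp only [Fin.snoc_castSucc, Fin.snoc_last] at h1 h2
  have h3 : ∏ i, ((2 : ℝ) ^ d i - 1) - ∏ i, (1 - (0 : ℝ) ^ d i) =
      (∏ i, ((2 : ℝ) ^ d i + -1)) * (1 + 0) + (∏ i, (1 + -(0 : ℝ) ^ d i)) * (0 + -1) := by
    simp only [← sub_eq_add_neg]
    ring
  rw [h3, h1, h2, ← Finset.sum_add_distrib]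
  refine Finset.sum_congr rfl fun S _ => ?_
  rw [hsign, Fin.prod_univ_castSucc, Fin.prod_univ_castSucc, Fin.prod_univ_castSucc]
  simp only [Fin.snoc_castSucc, Fin.snoc_last]
  by_cases hS : Fin.last k ∈ S
  · simp only [hS, if_true, mul_one, mul_zero, add_zero]
    rw [← Finset.prod_mul_distrib]
    refine Finset.prod_congr rfl fun i _ => ?_
    by_cases hi : i.castSucc ∈ S <;> simp [snocWeight, hS, hi, one_add_one_eq_two]
  · simp only [hS, if_false, mul_zero, zero_add, mul_neg, mul_one, neg_mul]
    rw [← Finset.prod_mul_distrib]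
    congr 1
    refine Finset.prod_congr rfl fun i _ => ?_
    by_cases hi : i.castSucc ∈ S <;> simp [snocWeight, hS, hi]

theorem exists_eq_two_of_sum_eq_add_one {k : ℕ} {d : Fin k → ℕ} (hd : ∀ i, 1 ≤ d i)
    (hsum : ∑ i, d i = k + 1) : ∃ i₀, d i₀ = 2 ∧ ∀ i, i ≠ i₀ → d i = 1 := by
  obtain ⟨i₀, hi₀⟩ : ∃ i₀, 2 ≤ d i₀ := by
    by_contra! h
    have : ∑ i, d i ≤ k := by
      simpa using Finset.sum_le_card_nsmul Finset.univ (fun i => d i) 1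
        fun i _ => Nat.le_of_lt_succ (h i)
    omega
  have h1 := Finset.add_sum_erase Finset.univ d (Finset.mem_univ i₀)
  have h2 : ∑ i ∈ Finset.univ.erase i₀, 1 = k - 1 := by simp
  have h3 : ∑ i ∈ Finset.univ.erase i₀, 1 ≤ ∑ i ∈ Finset.univ.erase i₀, d i :=
    Finset.sum_le_sum fun i _ => hd i
  have hk : 0 < k := i₀.pos
  have h4 := (Finset.sum_eq_sum_iff_of_le fun i _ => hd i).1
    (show ∑ i ∈ Finset.univ.erase i₀, 1 = ∑ i ∈ Finset.univ.erase i₀, d i by omega)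
  exact ⟨i₀, by omega, fun i hi => (h4 i (Finset.mem_erase.2 ⟨hi, Finset.mem_univ i⟩)).symm⟩

theorem two_le_prod_sub_prod {k : ℕ} {d : Fin k → ℕ} (hd : ∀ i, 1 ≤ d i)
    (hsum : ∑ i, d i = k + 1) :
    2 ≤ ∏ i, ((2 : ℝ) ^ d i - 1) - ∏ i, (1 - (0 : ℝ) ^ d i) := by
  obtain ⟨i₀, h2, h1⟩ := exists_eq_two_of_sum_eq_add_one hd hsum
  rw [Finset.prod_eq_single i₀ (fun i _ hi => by rw [h1 i hi]; norm_num) (by simp), h2,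
    Finset.prod_eq_one fun i _ => by rw [zero_pow (by have := hd i; omega), sub_zero]]
  norm_num

theorem prod_sub_prod_nonneg {k : ℕ} {d : Fin k → ℕ} (hsum : ∑ i, d i = k + 1) :
    0 ≤ ∏ i, ((2 : ℝ) ^ d i - 1) - ∏ i, (1 - (0 : ℝ) ^ d i) := by
  by_cases h : ∀ i, 1 ≤ d i
  · linarith [two_le_prod_sub_prod h hsum]
  · push Not at h
    obtain ⟨i, hi⟩ := h
    have hi : d i = 0 := by omega
    rw [Finset.prod_eq_zero (Finset.mem_univ i) (by simp [hi]),
      Finset.prod_eq_zero (Finset.mem_univ i) (by simp [hi]), sub_zero]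

variable {k : ℕ} {J : Fin k → Type*} [∀ i, Fintype (J i)] [∀ i, DecidableEq (J i)]
  [∀ i, Nonempty (J i)] {B : ∀ i, J i → Fin (k + 1) → ℝ} {ω : ∀ i, J i → ℝ}

open Classical in
/-- The vertices of the common refinement lying on all hypersurfaces. -/
noncomputable def commonVertices (B : ∀ i, J i → Fin (k + 1) → ℝ) (ω : ∀ i, J i → ℝ) :
    Finset (Fin (k + 1) → ℝ) :=
  (finite_vertices B ω).toFinset.filter fun p => ∀ i, 2 ≤ (active B ω p i).card

theorem mixedVol_eq_sum_vertices (hω : IsGenericLift B ω) :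
    mixedVol (k + 1) (Fin.snoc (fun i => convexHull ℝ (Set.range (B i)))
      (∑ i, convexHull ℝ (Set.range (B i)))) =
      ∑ p ∈ (finite_vertices B ω).toFinset,
        (∏ i, ((2 : ℝ) ^ ((active B ω p i).card - 1) - 1) -
          ∏ i, (1 - (0 : ℝ) ^ ((active B ω p i).card - 1))) *
            (volume (cell B (active B ω p) 1)).toReal := by
  have hvol : ∀ S : Finset (Fin (k + 1)),
      (volume (∑ l ∈ S, (Fin.snoc (fun i => convexHull ℝ (Set.range (B i)))
        (∑ i, convexHull ℝ (Set.range (B i))) : Fin (k + 1) → Set (Fin (k + 1) → ℝ)) l)).toReal =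
      ∑ p ∈ (finite_vertices B ω).toFinset,
        (∏ i, snocWeight S i ^ ((active B ω p i).card - 1)) *
          (volume (cell B (active B ω p) 1)).toReal := by
    intro S
    rw [sum_snoc_eq_sum_smul (fun i => convex_convexHull ℝ _)
      (fun i => (Set.range_nonempty (B i)).convexHull)]
    have hcell : ∑ i, snocWeight S i • convexHull ℝ (Set.range (B i)) =
        cell B (fun _ => Finset.univ) (snocWeight S) := by
      simp [cell]
    rw [hcell, volume_cell_univ (snocWeight_nonneg S) ω,
      ENNReal.toReal_sum fun p _ => isCompact_cell.measure_lt_top.ne]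
    refine Finset.sum_congr rfl fun p hp => ?_
    exact volume_cell_eq_prod_mul (hω p) (fun i => active_nonempty i)
      (by simpa using hp) (snocWeight_nonneg S)
  unfold mixedVol
  simp_rw [hvol, Finset.mul_sum, ← mul_assoc]
  rw [Finset.sum_comm]
  refine Finset.sum_congr rfl fun p _ => ?_
  rw [← Finset.sum_mul, sum_sign_mul_prod_snocWeight]

theorem card_commonVertices_le {A : ∀ i, J i → Fin (k + 1) → ℤ} (hB : ∀ i j l, B i j l = A i j l)
    (hω : IsGenericLift B ω) :
    ((commonVertices B ω).card : ℝ) * (1 / 2) ^ k ≤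
      mixedVol (k + 1) (Fin.snoc (fun i => convexHull ℝ (Set.range (B i)))
        (∑ i, convexHull ℝ (Set.range (B i)))) := by
  rw [mixedVol_eq_sum_vertices hω, ← nsmul_eq_mul, ← Finset.sum_const]
  have hsum : ∀ p ∈ (finite_vertices B ω).toFinset,
      ∑ i, ((active B ω p i).card - 1) = k + 1 := fun p hp =>
    card_sum_eq (hω p) (fun i => active_nonempty i) (by simpa using hp)
  refine le_trans (Finset.sum_le_sum fun p hp => ?_)
    (Finset.sum_le_sum_of_subset_of_nonneg (Finset.filter_subset _ _) fun p hp _ =>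
      mul_nonneg (prod_sub_prod_nonneg (hsum p hp)) ENNReal.toReal_nonneg)
  obtain ⟨hpV, hp2⟩ := Finset.mem_filter.1 hp
  have hd : ∀ i, 1 ≤ (active B ω p i).card - 1 := fun i => by have := hp2 i; omega
  obtain ⟨i₀, h2, h1⟩ := exists_eq_two_of_sum_eq_add_one hd (hsum p hpV)
  have hcard : ∀ i, (active B ω p i).card ≤ 3 := by
    intro i
    by_cases hi : i = i₀
    · subst hi; omega
    · have := h1 i hi; omega
  have hv := le_volume_cell hB (hω p) (fun i => active_nonempty i) (by simpa using hpV) hcard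
  have := two_le_prod_sub_prod hd (hsum p hpV)
  calc (1 / 2 : ℝ) ^ k = 2 * (1 / 2) ^ (k + 1) := by rw [pow_succ]; ring
    _ ≤ _ := mul_le_mul this hv (by positivity) (by linarith)

theorem prod_choose_two_eq_three (hω : IsGenericLift B ω) {p : Fin (k + 1) → ℝ}
    (hp : p ∈ commonVertices B ω) : ∏ i, (active B ω p i).card.choose 2 = 3 := by
  obtain ⟨hpV, hp2⟩ := Finset.mem_filter.1 hp
  have hsum := card_sum_eq (hω p) (fun i => active_nonempty i) (by simpa using hpV)
  obtain ⟨i₀, h2, h1⟩ := exists_eq_two_of_sum_eq_add_one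
    (fun i => by have := hp2 i; omega) hsum
  rw [Finset.prod_eq_single i₀ (fun i _ hi => ?_) (by simp)]
  · rw [show (active B ω p i₀).card = 3 by omega]
    rfl
  · rw [show (active B ω p i).card = 2 by have := h1 i hi; omega]
    rfl

end MixedVolume

section Edges

variable {k : ℕ} {J : Fin k → Type*} [∀ i, Fintype (J i)] [∀ i, Nonempty (J i)]
  {B : ∀ i, J i → Fin (k + 1) → ℝ} {ω : ∀ i, J i → ℝ}

theorem diffSpan_univ_eq_top
    (hfull : affineSpan ℝ (∑ i, convexHull ℝ (Set.range (B i))) = ⊤) :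
    diffSpan B (fun _ => Finset.univ) = ⊤ := by
  have a : ∀ i, J i := fun i => Classical.arbitrary _
  have hcell : ∑ i, convexHull ℝ (Set.range (B i)) = cell B (fun _ => Finset.univ) 1 := by
    simp [cell]
  rw [hcell] at hfull
  set c : Fin (k + 1) → ℝ := ∑ i, (1 : Fin k → ℝ) i • B i (a i) with hc
  have hle : affineSpan ℝ (cell B (fun _ => Finset.univ) 1) ≤
      AffineSubspace.mk' c (diffSpan B fun _ => Finset.univ) := by
    refine affineSpan_le.2 fun x hx => ?_
    exact AffineSubspace.mem_mk'.2 (sub_mem_diffSpan (fun i => Finset.mem_univ (a i)) hx)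
  rw [hfull, top_le_iff] at hle
  have := congrArg AffineSubspace.direction hle
  rwa [AffineSubspace.direction_mk', AffineSubspace.direction_top] at this

/-- Every edge of the common refinement has an endpoint, which is a vertex on all hypersurfaces. -/
theorem exists_commonVertex_of_edge
    (hfull : affineSpan ℝ (∑ i, convexHull ℝ (Set.range (B i))) = ⊤) {a b : ∀ i, J i}
    (hab : ∀ i, a i ≠ b i) (hli : LinearIndependent ℝ fun i => B i (b i) - B i (a i))
    {p : Fin (k + 1) → ℝ} (ha : ∀ i, a i ∈ active B ω p i) (hb : ∀ i, b i ∈ active B ω p i) :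
    ∃ q ∈ commonVertices B ω, ∀ i, a i ∈ active B ω q i ∧ b i ∈ active B ω q i := by
  classical
  obtain ⟨u, hu, i₁, j₁, hpos⟩ : ∃ u : Fin (k + 1) → ℝ,
      (∀ i, (B i (b i) - B i (a i)) ⬝ᵥ u = 0) ∧ ∃ i j, 0 < (B i j - B i (a i)) ⬝ᵥ u := by
    have hlt : Submodule.span ℝ (Set.range fun i => B i (b i) - B i (a i)) < ⊤ := by
      refine lt_top_iff_ne_top.2 fun h => ?_
      have := finrank_span_eq_card hli
      rw [h, finrank_top, Module.finrank_fin_fun, Fintype.card_fin] at this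
      omega
    obtain ⟨f, hf0, hf⟩ := Submodule.exists_le_ker_of_lt_top _ hlt
    have hfu : ∀ y, f y = y ⬝ᵥ fun l => f (Pi.single l 1) := by
      intro y
      conv_lhs => rw [pi_eq_sum_univ' y]
      simp [dotProduct]
    have hfv : ∀ i, f (B i (b i) - B i (a i)) = 0 := fun i =>
      LinearMap.mem_ker.1 (hf (Submodule.subset_span ⟨i, rfl⟩))
    obtain ⟨i, j, hij⟩ : ∃ i j, f (B i j - B i (a i)) ≠ 0 := by
      by_contra! h
      have hle : diffSpan B (fun _ => Finset.univ) ≤ LinearMap.ker f := by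
        refine Submodule.span_le.2 ?_
        rintro _ ⟨i, c, -, d, -, rfl⟩
        have h1 := h i c
        have h2 := h i d
        rw [map_sub, sub_eq_zero] at h1 h2
        rw [SetLike.mem_coe, LinearMap.mem_ker, map_sub, h1, h2, sub_self]
      rw [diffSpan_univ_eq_top hfull, top_le_iff] at hle
      exact hf0 (LinearMap.ker_eq_top.1 hle)
    rcases lt_or_gt_of_ne hij with h | h
    · refine ⟨-fun l => f (Pi.single l 1), fun i => ?_, i, j, ?_⟩
      · rw [dotProduct_neg, ← hfu, hfv, neg_zero]
      · rw [dotProduct_neg, ← hfu]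
        linarith
    · refine ⟨fun l => f (Pi.single l 1), fun i => ?_, i, j, ?_⟩
      · rw [← hfu, hfv]
      · rwa [← hfu]
  set s : (Σ i, J i) → ℝ := fun x => (B x.1 x.2 - B x.1 (a x.1)) ⬝ᵥ u with hs
  set δ : (Σ i, J i) → ℝ := fun x => liftVal B ω p x.1 (a x.1) - liftVal B ω p x.1 x.2 with hδ
  have hδ0 : ∀ x, 0 ≤ δ x := fun x => sub_nonneg.2 (mem_active.1 (ha x.1) x.2)
  obtain ⟨x₀, hx₀, hmin⟩ := Finset.exists_min_image (Finset.univ.filter fun x => 0 < s x)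
    (fun x => δ x / s x) ⟨⟨i₁, j₁⟩, by simpa [hs] using hpos⟩
  have hx₀ : 0 < s x₀ := (Finset.mem_filter.1 hx₀).2
  set t := δ x₀ / s x₀ with ht
  have ht0 : 0 ≤ t := div_nonneg (hδ0 _) hx₀.le
  have hval : ∀ i j, liftVal B ω (p + t • u) i (a i) - liftVal B ω (p + t • u) i j =
      δ ⟨i, j⟩ - t * s ⟨i, j⟩ := by
    intro i j
    simp only [hδ, hs, liftVal, dotProduct_add, dotProduct_smul, sub_dotProduct, smul_eq_mul]
    ring
  have hqa : ∀ i, a i ∈ active B ω (p + t • u) i := by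
    refine fun i => mem_active.2 fun j => ?_
    rw [← sub_nonneg, hval]
    by_cases hsx : 0 < s ⟨i, j⟩
    · have := hmin ⟨i, j⟩ (by simpa using hsx)
      rw [le_div_iff₀ hsx] at this
      linarith
    · have := mul_nonpos_of_nonneg_of_nonpos ht0 (not_lt.1 hsx)
      linarith [hδ0 ⟨i, j⟩]
  have hmem : ∀ i j, δ ⟨i, j⟩ - t * s ⟨i, j⟩ = 0 → j ∈ active B ω (p + t • u) i := by
    intro i j hij
    rw [← hval, sub_eq_zero] at hij
    exact mem_active.2 fun l => hij ▸ mem_active.1 (hqa i) l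
  have hqb : ∀ i, b i ∈ active B ω (p + t • u) i := by
    refine fun i => hmem i _ ?_
    have h1 : δ ⟨i, b i⟩ = 0 := sub_eq_zero.2 (liftVal_eq_of_mem_active (ha i) (hb i))
    have h2 : s ⟨i, b i⟩ = 0 := hu i
    rw [h1, h2, mul_zero, sub_zero]
  have hqx : x₀.2 ∈ active B ω (p + t • u) x₀.1 := by
    refine hmem _ _ ?_
    rw [Sigma.eta, ht, div_mul_cancel₀ _ hx₀.ne', sub_self]
  refine ⟨p + t • u, Finset.mem_filter.2 ⟨(finite_vertices B ω).mem_toFinset.2 ?_, fun i => ?_⟩,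
    fun i => ⟨hqa i, hqb i⟩⟩
  · have hnot : B x₀.1 x₀.2 - B x₀.1 (a x₀.1) ∉
        Submodule.span ℝ (Set.range fun i => B i (b i) - B i (a i)) := by
      intro h
      have hle : Submodule.span ℝ (Set.range fun i => B i (b i) - B i (a i)) ≤
          LinearMap.ker ((dotProductBilin ℝ ℝ).flip u : (Fin (k + 1) → ℝ) →ₗ[ℝ] ℝ) := by
        refine Submodule.span_le.2 ?_
        rintro _ ⟨i, rfl⟩
        exact hu i
      exact hx₀.ne' (hle h)
    have hspan := (hli.finSnoc hnot).span_eq_top_of_card_eq_finrank' (by simp)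
    rw [Set.mem_ofPred_eq, eq_top_iff, ← hspan]
    refine Submodule.span_le.2 ?_
    rintro _ ⟨l, rfl⟩
    induction l using Fin.lastCases with
    | last =>
      rw [Fin.snoc_last]
      exact Submodule.subset_span ⟨_, _, hqa _, _, hqx, rfl⟩
    | cast i =>
      rw [Fin.snoc_castSucc]
      exact Submodule.subset_span ⟨i, _, hqa i, _, hqb i, rfl⟩
  · exact Finset.one_lt_card.2 ⟨a i, hqa i, b i, hqb i, hab i⟩

theorem two_pow_le_factorial_succ (k : ℕ) : 2 ^ k ≤ (k + 1).factorial := by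
  simpa using Nat.factorial_mul_pow_le_factorial (m := 1) (n := k) |>.trans_eq (by rw [add_comm])

end Edges

end TropicalRefinement

/-- STATEMENT 11 (Malajovich-type edge bound), with `n = k + 1 ≥ 2` and `n − 1 = k`
configurations: for a.e. lift `ω`, the number of tuples of unordered pairs
`({a₁,b₁},…,{a_k,b_k})` that index an edge of the common refinement of the `k`
tropical hypersurfaces (differences linearly independent and jointly attaining
the lifted maxima exactly at `{aᵢ,bᵢ}` for some normal `p`) is at most
`3 · n! · MV(conv A₁, …, conv A_k, conv A₁ + ⋯ + conv A_k)`. -/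
theorem edge_count_bound (k : ℕ) (hk : 1 ≤ k) (m : Fin k → ℕ)
    (A : ∀ i : Fin k, Fin (m i) → Fin (k + 1) → ℤ)
    (hfull : affineSpan ℝ (∑ i, convexHull ℝ (Set.range (coeConf (A i)))) = ⊤) :
    ∀ᵐ ω ∂(volume : Measure (∀ i : Fin k, Fin (m i) → ℝ)),
      (({e : ∀ i : Fin k, Sym2 (Fin (m i)) |
          ∃ a b : ∀ i : Fin k, Fin (m i),
            (∀ i, e i = s(a i, b i)) ∧ (∀ i, a i ≠ b i) ∧
            LinearIndependent ℝ (fun i => coeConf (A i) (b i) - coeConf (A i) (a i)) ∧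
            ∃ p : Fin (k + 1) → ℝ, ∀ i, ∀ j : Fin (m i),
              (ω i j + dotp (k + 1) (coeConf (A i) j) p ≤
                ω i (a i) + dotp (k + 1) (coeConf (A i) (a i)) p) ∧
              (ω i j + dotp (k + 1) (coeConf (A i) j) p =
                  ω i (a i) + dotp (k + 1) (coeConf (A i) (a i)) p ↔
                j = a i ∨ j = b i)}).ncard : ℝ) ≤
        3 * (Nat.factorial (k + 1)) *
          mixedVol (k + 1)
            (Fin.snoc (fun i : Fin k => convexHull ℝ (Set.range (coeConf (A i))))
              (∑ i, convexHull ℝ (Set.range (coeConf (A i))))) := by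

  classical
  have hne : ∀ i, Nonempty (Fin (m i)) := by
    intro i
    by_contra h
    rw [not_nonempty_iff] at h
    have hempty : ∑ i, convexHull ℝ (Set.range (coeConf (A i))) = ∅ := by
      refine Set.eq_empty_of_forall_notMem fun x hx => ?_
      obtain ⟨g, hg, -⟩ := (Set.mem_fintype_sum _ _).1 hx
      have := hg i
      simp [Set.range_eq_empty] at this
    rw [hempty, AffineSubspace.span_empty] at hfull
    exact AffineSubspace.bot_ne_top ℝ _ _ hfull
  filter_upwards [TropicalRefinement.ae_isGenericLift fun i => coeConf (A i)] with ω hω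
  set B : ∀ i, Fin (m i) → Fin (k + 1) → ℝ := fun i => coeConf (A i)
  set V := TropicalRefinement.commonVertices B ω
  have hV := TropicalRefinement.card_commonVertices_le (B := B) (A := A) (fun _ _ _ => rfl) hω
  refine le_trans (b := ((3 * V.card : ℕ) : ℝ)) (Nat.cast_le.2 ?_) ?_
  · let T : Finset (∀ i, Sym2 (Fin (m i))) := V.biUnion fun q => Fintype.piFinset fun i =>
      (TropicalRefinement.active B ω q i).offDiag.image (Function.uncurry Sym2.mk)
    have hT : T.card ≤ 3 * V.card := by
      rw [mul_comm]
      refine Finset.card_biUnion_le_card_mul _ _ _ fun q hq => ?_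
      rw [Fintype.card_piFinset]
      simp_rw [Sym2.card_image_offDiag]
      exact (TropicalRefinement.prod_choose_two_eq_three hω hq).le
    refine le_trans ?_ hT
    rw [← Set.ncard_coe_finset]
    refine Set.ncard_le_ncard ?_ T.finite_toSet
    rintro e ⟨a, b, he, hab, hli, p, hp⟩
    have ha : ∀ i, a i ∈ TropicalRefinement.active B ω p i := fun i =>
      TropicalRefinement.mem_active.2 fun j => (hp i j).1
    have hb : ∀ i, b i ∈ TropicalRefinement.active B ω p i := fun i =>
      TropicalRefinement.mem_active.2 fun j => ((hp i j).1).trans_eq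
        ((hp i (b i)).2.2 (Or.inr rfl)).symm
    obtain ⟨q, hq, hqab⟩ :=
      TropicalRefinement.exists_commonVertex_of_edge hfull hab hli ha hb
    refine Finset.mem_coe.2 (Finset.mem_biUnion.2 ⟨q, hq, Fintype.mem_piFinset.2 fun i => ?_⟩)
    exact Finset.mem_image.2 ⟨(a i, b i),
      Finset.mem_offDiag.2 ⟨(hqab i).1, (hqab i).2, hab i⟩, (he i).symm⟩
  · set MV := mixedVol (k + 1)
      (Fin.snoc (fun i : Fin k => convexHull ℝ (Set.range (coeConf (A i))))
        (∑ i, convexHull ℝ (Set.range (coeConf (A i)))))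
    have h1 : ((2 : ℝ) ^ k) ≤ (k + 1).factorial := by
      exact_mod_cast TropicalRefinement.two_pow_le_factorial_succ k
    have h2 : (V.card : ℝ) * (1 / 2) ^ k ≤ MV := hV
    have h3 : 0 ≤ MV := le_trans (by positivity) h2
    have h4 : (V.card : ℝ) ≤ 2 ^ k * MV := by
      calc (V.card : ℝ) = 2 ^ k * (V.card * (1 / 2) ^ k) := by
            rw [mul_left_comm, ← mul_pow]
            norm_num
        _ ≤ _ := by gcongr
    have h5 := mul_le_mul_of_nonneg_right h1 h3
    push_cast
    linarith
end
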